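/- arXiv:1207.0390 — 7 statements merged into one kernel-verified Lean document; each statement's English description precedes it below -/
import Mathlib

section
/- Let M be a q-isometry (Mᵀ J M = J). If z ∈ ℂ is a complex eigenvalue of M with |z| ≠ 1, then z is real, the real eigenspace ker(M − z·Id) ⊆ ℝ^{n+1} is one-dimensional, and every vector v in this eigenspace is isotropic: q(v) = 0. -/
open Matrix

noncomputable section

/-- The Minkowski form matrix `diag(1, -1, …, -1)` on `ℝ^{n+1}`. -/
def Jmat (n : ℕ) : Matrix (Fin (n + 1)) (Fin (n + 1)) ℝ :=
  Matrix.diagonal fun i => if i = 0 then (1 : ℝ) else -1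

/-- The Minkowski quadratic form `q(v) = vᵀ J v` of signature `(1, n)`. -/
def qform (n : ℕ) (v : Fin (n + 1) → ℝ) : ℝ := v ⬝ᵥ (Jmat n).mulVec v

/-- The eigenspace `ker (M - λ·Id)` of a matrix `M`, as a submodule of `ℝ^{n+1}`. -/
def eigSpace (n : ℕ) (M : Matrix (Fin (n + 1)) (Fin (n + 1)) ℝ) (lam : ℝ) :
    Submodule ℝ (Fin (n + 1) → ℝ) :=
  LinearMap.ker (M.mulVecLin - lam • (LinearMap.id : (Fin (n + 1) → ℝ) →ₗ[ℝ] (Fin (n + 1) → ℝ)))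

/-- The polar bilinear form. -/
def Bform (n : ℕ) (v w : Fin (n + 1) → ℝ) : ℝ := v ⬝ᵥ (Jmat n).mulVec w

lemma Bform_expand (n : ℕ) (v w : Fin (n + 1) → ℝ) :
    Bform n v w = v 0 * w 0 - ∑ i : Fin n, v i.succ * w i.succ := by
  simp [Bform, Jmat, dotProduct, Matrix.mulVec_diagonal, Fin.sum_univ_succ, Fin.succ_ne_zero]
  ring

lemma Bform_add_left (n : ℕ) (u v w : Fin (n + 1) → ℝ) :
    Bform n (u + v) w = Bform n u w + Bform n v w := by
  simp [Bform, add_dotProduct]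

lemma Bform_smul_left (n : ℕ) (a : ℝ) (v w : Fin (n + 1) → ℝ) :
    Bform n (a • v) w = a * Bform n v w := by
  simp [Bform, smul_dotProduct]

lemma Bform_comm (n : ℕ) (v w : Fin (n + 1) → ℝ) : Bform n v w = Bform n w v := by
  simp only [Bform_expand, mul_comm]

lemma Bform_add_right (n : ℕ) (u v w : Fin (n + 1) → ℝ) :
    Bform n w (u + v) = Bform n w u + Bform n w v := by
  simp [Bform, Matrix.mulVec_add]

lemma Bform_smul_right (n : ℕ) (a : ℝ) (v w : Fin (n + 1) → ℝ) :
    Bform n w (a • v) = a * Bform n w v := by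
  simp [Bform, Matrix.mulVec_smul]

lemma Bform_isom (n : ℕ) (M : Matrix (Fin (n + 1)) (Fin (n + 1)) ℝ)
    (hM : Mᵀ * Jmat n * M = Jmat n) (v w : Fin (n + 1) → ℝ) :
    Bform n (M.mulVec v) (M.mulVec w) = Bform n v w := by
  have h : Bform n v w = v ⬝ᵥ (Mᵀ * Jmat n * M).mulVec w := by rw [hM]; rfl
  rw [h, ← Matrix.mulVec_mulVec, ← Matrix.mulVec_mulVec, Matrix.dotProduct_mulVec v,
    Matrix.vecMul_transpose]
  rfl

lemma eq_zero_of_zero (n : ℕ) (v : Fin (n + 1) → ℝ) (h0 : v 0 = 0) (h : Bform n v v = 0) :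
    v = 0 := by
  rw [Bform_expand, h0] at h
  have h1 : ∑ i : Fin n, v i.succ * v i.succ = 0 := by linarith
  rw [Finset.sum_eq_zero_iff_of_nonneg (fun i _ => mul_self_nonneg _)] at h1
  funext i
  refine Fin.cases h0 (fun j => ?_) i
  simpa using h1 j (Finset.mem_univ j)

lemma isotropic_prop (n : ℕ) (v w : Fin (n + 1) → ℝ) (hv : Bform n v v = 0)
    (hw : Bform n w w = 0) (hvw : Bform n v w = 0) : v 0 • w = w 0 • v := by
  have : v 0 • w + (-w 0) • v = 0 := by
    apply eq_zero_of_zero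
    · simp; ring
    · simp only [Bform_add_left, Bform_add_right, Bform_smul_left, Bform_smul_right,
        Bform_comm n w v, hv, hw, hvw]
      ring
  rw [neg_smul] at this
  exact add_neg_eq_zero.mp this

lemma exists_eigvec (n : ℕ) (M : Matrix (Fin (n + 1)) (Fin (n + 1)) ℝ) (z : ℂ)
    (hz : Polynomial.aeval z M.charpoly = 0) :
    ∃ x y : Fin (n + 1) → ℝ, (x ≠ 0 ∨ y ≠ 0) ∧
      M.mulVec x = z.re • x + (-z.im) • y ∧ M.mulVec y = z.im • x + z.re • y := by
  have h1 : (Matrix.scalar (Fin (n + 1)) z - M.map (algebraMap ℝ ℂ)).det = 0 := by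
    rw [← Matrix.eval_charpoly, Matrix.charpoly_map, Polynomial.eval_map_algebraMap, hz]
  obtain ⟨w, hw, hw0⟩ := Matrix.exists_mulVec_eq_zero_iff.mpr h1
  have key : ∀ i, ∑ j, (M i j : ℂ) * w j = z * w i := by
    intro i
    have := congrFun hw0 i
    rw [Matrix.sub_mulVec] at this
    simp only [Pi.sub_apply, Pi.zero_apply, sub_eq_zero] at this
    simp [Matrix.scalar_apply, Matrix.mulVec_diagonal] at this
    rw [this]
    simp [Matrix.mulVec, dotProduct]
  refine ⟨fun i => (w i).re, fun i => (w i).im, ?_, ?_, ?_⟩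
  · by_contra! h
    apply hw
    funext i
    exact Complex.ext (congrFun h.1 i) (congrFun h.2 i)
  · funext i
    have := congrArg Complex.re (key i)
    simp at this
    simp [Matrix.mulVec, dotProduct, this]
    ring
  · funext i
    have := congrArg Complex.im (key i)
    simp at this
    simp [Matrix.mulVec, dotProduct, this]
    ring

theorem stmt_1 (n : ℕ) (hn : 1 ≤ n) (M : Matrix (Fin (n + 1)) (Fin (n + 1)) ℝ)
    (hM : Mᵀ * Jmat n * M = Jmat n) (z : ℂ)
    (hz : Polynomial.aeval z M.charpoly = 0) (habs : ‖z‖ ≠ 1) :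
    z.im = 0 ∧
    Module.finrank ℝ (eigSpace n M z.re) = 1 ∧
    ∀ v ∈ eigSpace n M z.re, qform n v = 0 := by
  obtain ⟨x, y, hxy, hx, hy⟩ := exists_eigvec n M z hz
  have hN : z.re ^ 2 + z.im ^ 2 ≠ 1 := by
    intro h
    apply habs
    rw [Complex.norm_def, Complex.normSq_apply, ← sq, ← sq, h, Real.sqrt_one]
  generalize z.re = a at *
  generalize z.im = b at *
  have e1 := Bform_isom n M hM x x
  have e2 := Bform_isom n M hM y y
  have e3 := Bform_isom n M hM x y
  simp only [hx, hy, Bform_add_left, Bform_add_right, Bform_smul_left, Bform_smul_right,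
    Bform_comm n y x] at e1 e2 e3
  obtain ⟨hp, hr, hs⟩ : Bform n x x = 0 ∧ Bform n y y = 0 ∧ Bform n x y = 0 := by
    generalize Bform n x x = p at *
    generalize Bform n y y = r at *
    generalize Bform n x y = s at *
    have hpr : p + r = 0 := by
      have : (a ^ 2 + b ^ 2 - 1) * (p + r) = 0 := by linear_combination e1 + e2
      exact (mul_eq_zero.mp this).resolve_left (sub_ne_zero.mpr hN)
    have hr : r = -p := by linarith
    subst hr
    have hK : (1 - (a ^ 2 - b ^ 2)) ^ 2 + (2 * a * b) ^ 2 ≠ 0 := by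
      intro h
      have hA : 1 - (a ^ 2 - b ^ 2) = 0 := by nlinarith
      have hC : 2 * a * b = 0 := by nlinarith
      have : (a ^ 2 + b ^ 2 - 1) * (a ^ 2 + b ^ 2 + 1) = 0 := by
        linear_combination (-(1 + (a ^ 2 - b ^ 2))) * hA + (2 * a * b) * hC
      rcases mul_eq_zero.mp this with h | h
      · exact hN (by linarith)
      · nlinarith
    have f1 : p * (1 - (a ^ 2 - b ^ 2)) = - (2 * a * b) * s := by linear_combination -e1
    have f2 : s * (1 - (a ^ 2 - b ^ 2)) = (2 * a * b) * p := by linear_combination -e3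
    have hp : p = 0 := by
      have : ((1 - (a ^ 2 - b ^ 2)) ^ 2 + (2 * a * b) ^ 2) * p = 0 := by
        linear_combination (1 - (a ^ 2 - b ^ 2)) * f1 - (2 * a * b) * f2
      exact (mul_eq_zero.mp this).resolve_left hK
    have hs : s = 0 := by
      have : ((1 - (a ^ 2 - b ^ 2)) ^ 2 + (2 * a * b) ^ 2) * s = 0 := by
        linear_combination (1 - (a ^ 2 - b ^ 2)) * f2 + (2 * a * b) * f1
      exact (mul_eq_zero.mp this).resolve_left hK
    exact ⟨hp, by simp [hp], hs⟩
  have hprop := isotropic_prop n x y hp hr hs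
  have h0 : x 0 ≠ 0 ∨ y 0 ≠ 0 :=
    hxy.imp (fun h h' => h (eq_zero_of_zero n x h' hp)) (fun h h' => h (eq_zero_of_zero n y h' hr))
  have hb : b = 0 := by
    have h := congrArg M.mulVec hprop
    rw [Matrix.mulVec_smul, Matrix.mulVec_smul, hx, hy] at h
    have h := congrFun h 0
    simp at h
    have h2 : b * (x 0 ^ 2 + y 0 ^ 2) = 0 := by linear_combination h
    refine (mul_eq_zero.mp h2).resolve_right ?_
    rcases h0 with h | h <;> positivity
  have hmem : ∀ v, v ∈ eigSpace n M a ↔ M.mulVec v = a • v := by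
    intro v
    simp [eigSpace, sub_eq_zero]
  have hiso : ∀ v ∈ eigSpace n M a, ∀ w ∈ eigSpace n M a, Bform n v w = 0 := by
    intro v hv w hw
    have h := Bform_isom n M hM v w
    rw [(hmem v).1 hv, (hmem w).1 hw, Bform_smul_left, Bform_smul_right] at h
    have h2 : (a ^ 2 + b ^ 2 - 1) * Bform n v w = 0 := by
      rw [hb]; linear_combination h
    exact (mul_eq_zero.mp h2).resolve_left (sub_ne_zero.mpr hN)
  refine ⟨hb, ?_, fun v hv => hiso v hv v hv⟩
  have hex : ∃ u ∈ eigSpace n M a, u ≠ 0 := by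
    rcases hxy with h | h
    · exact ⟨x, (hmem x).2 (by simp [hx, hb]), h⟩
    · exact ⟨y, (hmem y).2 (by simp [hy, hb]), h⟩
  obtain ⟨u, hu, hu0⟩ := hex
  have hu00 : u 0 ≠ 0 := fun h => hu0 (eq_zero_of_zero n u h (hiso u hu u hu))
  refine finrank_eq_one_iff'.mpr ⟨⟨u, hu⟩, by simpa using hu0, ?_⟩
  rintro ⟨w, hw⟩
  refine ⟨(u 0)⁻¹ * w 0, Subtype.ext ?_⟩
  have := isotropic_prop n u w (hiso u hu u hu) (hiso w hw w hw) (hiso u hu w hw)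
  change ((u 0)⁻¹ * w 0) • u = w
  rw [mul_smul, ← this, smul_smul, inv_mul_cancel₀ hu00, one_smul]
end
end

section
/- Let M be a q-isometry (Mᵀ J M = J) that preserves the future cone, and suppose M has some complex eigenvalue of modulus different from 1. Then there exists a real number λ > 1 such that: λ and λ⁻¹ are roots of multiplicity one of the characteristic polynomial of M; every complex eigenvalue of M other than λ and λ⁻¹ has modulus 1; the real eigenspaces ker(M − λ·Id) and ker(M − λ⁻¹·Id) are one-dimensional and consist of isotropic vectors (q vanishes on them); and M is semisimple. -/
open Matrix

noncomputable section

/-- `M` is semisimple as an `ℝ`-linear endomorphism of `ℝ^{n+1}`: every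
`M`-invariant subspace has an `M`-invariant complement. -/
def IsSemisimpleMat (n : ℕ) (M : Matrix (Fin (n + 1)) (Fin (n + 1)) ℝ) : Prop :=
  ∀ p : Submodule ℝ (Fin (n + 1) → ℝ), (∀ v ∈ p, M.mulVec v ∈ p) →
    ∃ p' : Submodule ℝ (Fin (n + 1) → ℝ), (∀ v ∈ p', M.mulVec v ∈ p') ∧ IsCompl p p'

/-- `M` preserves the future cone `{v : q(v) > 0 ∧ v₀ > 0}`. -/
def PreservesFutureCone (n : ℕ) (M : Matrix (Fin (n + 1)) (Fin (n + 1)) ℝ) : Prop :=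
  ∀ v : Fin (n + 1) → ℝ, 0 < qform n v → 0 < v 0 →
    0 < qform n (M.mulVec v) ∧ 0 < M.mulVec v 0

/-- The Minkowski bilinear form. -/
def mB (n : ℕ) : LinearMap.BilinForm ℝ (Fin (n + 1) → ℝ) := Matrix.toBilin' (Jmat n)

lemma mB_dot (n : ℕ) (x y : Fin (n + 1) → ℝ) : mB n x y = x ⬝ᵥ (Jmat n).mulVec y := by
  simp [mB, Matrix.toBilin'_apply']

lemma qform_eq (n : ℕ) (x : Fin (n + 1) → ℝ) : qform n x = mB n x x := by
  rw [mB_dot]; rfl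

lemma mB_apply (n : ℕ) (x y : Fin (n + 1) → ℝ) :
    mB n x y = x 0 * y 0 - ∑ i : Fin n, x i.succ * y i.succ := by
  rw [mB_dot, Jmat]
  simp [dotProduct, Matrix.mulVec_diagonal, Fin.sum_univ_succ, Fin.succ_ne_zero,
    Finset.sum_neg_distrib, sub_eq_add_neg]

lemma mB_symm (n : ℕ) (x y : Fin (n + 1) → ℝ) : mB n x y = mB n y x := by
  simp [mB_apply, mul_comm]

lemma mB_nondeg (n : ℕ) : (mB n).Nondegenerate := by
  unfold mB
  rw [LinearMap.BilinForm.nondegenerate_toBilin'_iff_det_ne_zero, Jmat, Matrix.det_diagonal,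
    Finset.prod_ne_zero_iff]
  intro i _
  split_ifs <;> norm_num

lemma mB_isom {n : ℕ} {M : Matrix (Fin (n + 1)) (Fin (n + 1)) ℝ}
    (hM : Mᵀ * Jmat n * M = Jmat n) (x y : Fin (n + 1) → ℝ) :
    mB n (M.mulVec x) (M.mulVec y) = mB n x y := by
  rw [mB_dot, mB_dot]
  conv_rhs => rw [← hM]
  rw [← Matrix.mulVec_mulVec, ← Matrix.mulVec_mulVec, Matrix.dotProduct_mulVec x,
    Matrix.vecMul_transpose]

lemma zero_of_isotropic {n : ℕ} {x : Fin (n + 1) → ℝ} (h : mB n x x = 0) (h0 : x 0 = 0) :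
    x = 0 := by
  rw [mB_apply, h0] at h
  have h1 : ∑ i : Fin n, x i.succ * x i.succ = 0 := by linarith
  rw [Finset.sum_eq_zero_iff_of_nonneg (fun i _ => mul_self_nonneg _)] at h1
  funext i
  refine Fin.cases h0 (fun j => ?_) i
  simpa using h1 j (Finset.mem_univ _)

lemma dep_of_isotropic {n : ℕ} {x y : Fin (n + 1) → ℝ} (hx : mB n x x = 0)
    (hy : mB n y y = 0) (hxy : mB n x y = 0) : x 0 • y = y 0 • x := by
  have : x 0 • y - y 0 • x = 0 := by
    apply zero_of_isotropic (n := n)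
    · simp [hx, hy, hxy, mB_symm n y x]
    · simp [mul_comm]
  exact sub_eq_zero.mp this

lemma dep_of_isotropic' {n : ℕ} {x y : Fin (n + 1) → ℝ} (hx : mB n x x = 0) (hx0 : x ≠ 0)
    (hy : mB n y y = 0) (hxy : mB n x y = 0) : ∃ c : ℝ, y = c • x := by
  have h0 : x 0 ≠ 0 := fun h => hx0 (zero_of_isotropic hx h)
  refine ⟨y 0 / x 0, ?_⟩
  rw [div_eq_inv_mul, mul_smul, ← dep_of_isotropic hx hy hxy, smul_smul, inv_mul_cancel₀ h0,
    one_smul]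

lemma mulVec_inj {n : ℕ} {M : Matrix (Fin (n + 1)) (Fin (n + 1)) ℝ}
    (hM : Mᵀ * Jmat n * M = Jmat n) {x : Fin (n + 1) → ℝ} (h : M.mulVec x = 0) : x = 0 := by
  apply (mB_nondeg n).1
  intro y
  rw [← mB_isom hM, h]; simp

/-- A complex eigenvalue of modulus `≠ 1` is real with a real isotropic eigenvector. -/
lemma real_eig {n : ℕ} {M : Matrix (Fin (n + 1)) (Fin (n + 1)) ℝ}
    (hM : Mᵀ * Jmat n * M = Jmat n) {z : ℂ} (hz : Polynomial.aeval z M.charpoly = 0)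
    (h1 : ‖z‖ ≠ 1) :
    ∃ (s : ℝ) (u : Fin (n + 1) → ℝ), z = s ∧ u ≠ 0 ∧ M.mulVec u = s • u ∧ mB n u u = 0 := by
  have hdet : (Matrix.scalar _ z - M.map (algebraMap ℝ ℂ)).det = 0 := by
    rw [← Matrix.eval_charpoly, Matrix.charpoly_map, Polynomial.eval_map_algebraMap, hz]
  obtain ⟨w, hw0, hw⟩ := Matrix.exists_mulVec_eq_zero_iff.mpr hdet
  have hw' : ∀ i, ∑ j, (M i j : ℂ) * w j = z * w i := by
    intro i
    have := congrFun hw i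
    rw [Matrix.sub_mulVec] at this
    simp only [Matrix.scalar_apply, Pi.sub_apply, Pi.zero_apply,
      Matrix.mulVec, dotProduct, Matrix.map_apply] at this
    simpa [Matrix.mulVec_diagonal, Matrix.diagonal_apply] using (sub_eq_zero.mp this).symm
  set a : Fin (n + 1) → ℝ := fun i => (w i).re with ha
  set b : Fin (n + 1) → ℝ := fun i => (w i).im with hb
  set s := z.re with hs
  set t := z.im with ht
  have hMa : M.mulVec a = s • a - t • b := by
    funext i
    have := congrArg Complex.re (hw' i)
    simpa [Matrix.mulVec, dotProduct] using this
  have hMb : M.mulVec b = t • a + s • b := by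
    funext i
    have := congrArg Complex.im (hw' i)
    simp [Matrix.mulVec, dotProduct] at this ⊢
    rw [this]; ring
  have hnorm : s ^ 2 + t ^ 2 ≠ 1 := by
    intro h
    apply h1
    have : ‖z‖ ^ 2 = 1 := by
      rw [← Complex.normSq_eq_norm_sq, Complex.normSq_apply]; nlinarith
    nlinarith [norm_nonneg z]
  have hba := mB_symm n b a
  have eA := mB_isom hM a a
  have eD := mB_isom hM b b
  have eC := mB_isom hM a b
  rw [hMa] at eA eC
  rw [hMb] at eD eC
  simp only [map_add, map_sub, map_smul, LinearMap.add_apply, LinearMap.sub_apply,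
    LinearMap.smul_apply, smul_eq_mul, hba] at eA eD eC
  set A := mB n a a
  set D := mB n b b
  set C := mB n a b
  have hAD : D = -A := by
    have : (s ^ 2 + t ^ 2 - 1) * (A + D) = 0 := by linear_combination eA + eD
    rcases mul_eq_zero.mp this with h | h
    · exact absurd (by linarith) hnorm
    · linarith
  rw [hAD] at eA eC eD
  have hPQ : (s ^ 2 - t ^ 2 - 1) ^ 2 + (2 * s * t) ^ 2 ≠ 0 := by
    intro h
    have e1 : s ^ 2 - t ^ 2 - 1 = 0 := by nlinarith [sq_nonneg (s ^ 2 - t ^ 2 - 1), sq_nonneg (2 * s * t)]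
    have e2 : 2 * s * t = 0 := by nlinarith [sq_nonneg (s ^ 2 - t ^ 2 - 1), sq_nonneg (2 * s * t)]
    apply hnorm
    have : (s ^ 2 + t ^ 2) ^ 2 = 1 := by
      linear_combination (s ^ 2 - t ^ 2 + 1) * e1 + (2 * s * t) * e2
    nlinarith [sq_nonneg s, sq_nonneg t]
  have f1 : (s ^ 2 - t ^ 2 - 1) * A - (2 * s * t) * C = 0 := by linear_combination eA
  have f2 : (2 * s * t) * A + (s ^ 2 - t ^ 2 - 1) * C = 0 := by linear_combination eC
  have hA : A = 0 := by
    have : ((s ^ 2 - t ^ 2 - 1) ^ 2 + (2 * s * t) ^ 2) * A = 0 := by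
      linear_combination (s ^ 2 - t ^ 2 - 1) * f1 + (2 * s * t) * f2
    exact (mul_eq_zero.mp this).resolve_left hPQ
  have hC : C = 0 := by
    have : ((s ^ 2 - t ^ 2 - 1) ^ 2 + (2 * s * t) ^ 2) * C = 0 := by
      linear_combination (s ^ 2 - t ^ 2 - 1) * f2 - (2 * s * t) * f1
    exact (mul_eq_zero.mp this).resolve_left hPQ
  have hD : D = 0 := by rw [hAD, hA, neg_zero]
  have key : t = 0 → z = (s : ℂ) := fun h => Complex.ext (by simp [hs]) (by simpa [ht] using h)
  by_cases ha0 : a = 0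
  · have hb0 : b ≠ 0 := by
      intro hb0
      apply hw0
      funext i
      exact Complex.ext (congrFun ha0 i) (congrFun hb0 i)
    have ht0 : t = 0 := by
      rw [ha0] at hMa
      simpa [hb0] using hMa
    refine ⟨s, b, key ht0, hb0, ?_, hD⟩
    rw [hMb, ht0]; simp
  · obtain ⟨k, hk⟩ := dep_of_isotropic' hA ha0 hD hC
    have ht0 : t = 0 := by
      have e : M.mulVec b = k • M.mulVec a := by rw [hk, Matrix.mulVec_smul]
      rw [hMa, hMb, hk] at e
      have e' : (t * (1 + k ^ 2)) • a = 0 := by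
        rw [← sub_eq_zero] at e
        rw [← e]; module
      have := (smul_eq_zero.mp e').resolve_right ha0
      exact (mul_eq_zero.mp this).resolve_right (by positivity)
    refine ⟨s, a, key ht0, ha0, ?_, hA⟩
    rw [hMa, ht0]; simp

lemma eig_pos {n : ℕ} {M : Matrix (Fin (n + 1)) (Fin (n + 1)) ℝ}
    (hM : Mᵀ * Jmat n * M = Jmat n) (hcone : PreservesFutureCone n M)
    {s : ℝ} {u : Fin (n + 1) → ℝ} (hu : u ≠ 0) (hs : M.mulVec u = s • u)
    (hq : mB n u u = 0) : 0 < s := by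
  have h0 : u 0 ≠ 0 := fun h => hu (zero_of_isotropic hq h)
  have hs0 : s ≠ 0 := by
    rintro rfl
    exact hu (mulVec_inj hM (by simpa using hs))
  set v := (u 0)⁻¹ • u with hv
  have hv0 : v 0 = 1 := by simp [hv, h0]
  have hMv : M.mulVec v = s • v := by rw [hv, Matrix.mulVec_smul, hs, smul_comm]
  have hqv : mB n v v = 0 := by simp [hv, hq]
  set e : Fin (n + 1) → ℝ := Pi.single 0 1 with he
  have hee : mB n e e = 1 := by simp [mB_apply, he]
  have hve : mB n v e = 1 := by simp [mB_apply, he, hv0]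
  have main : ∀ ε : ℝ, 0 < ε → 0 < s + ε * M.mulVec e 0 := by
    intro ε hε
    have := (hcone (v + ε • e) ?_ ?_).2
    · rw [Matrix.mulVec_add, hMv, Matrix.mulVec_smul] at this
      simpa [hv0] using this
    · rw [qform_eq]
      simp [hqv, hve, hee, mB_symm n e v]
      positivity
    · simp [hv0, he]; positivity
  by_contra hneg
  have hs' : s < 0 := lt_of_le_of_ne (not_lt.mp hneg) hs0
  rcases le_or_gt (M.mulVec e 0) 0 with h | h
  · have := main 1 one_pos
    linarith
  · have := main (-s / M.mulVec e 0) (div_pos (by linarith) h)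
    rw [div_mul_cancel₀ _ h.ne'] at this
    linarith

lemma aeval_of_eig {n : ℕ} {M : Matrix (Fin (n + 1)) (Fin (n + 1)) ℝ} {s : ℝ}
    {u : Fin (n + 1) → ℝ} (hu : u ≠ 0) (hs : M.mulVec u = s • u) :
    Polynomial.aeval (s : ℂ) M.charpoly = 0 := by
  have h : M.charpoly.eval s = 0 := by
    rw [Matrix.eval_charpoly, ← Matrix.exists_mulVec_eq_zero_iff]
    refine ⟨u, hu, ?_⟩
    rw [Matrix.sub_mulVec, hs, sub_eq_zero]
    funext i
    simp [Matrix.mulVec_diagonal]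
  have := Polynomial.aeval_algebraMap_apply (A := ℝ) ℂ s M.charpoly
  rw [Polynomial.coe_aeval_eq_eval, h, map_zero] at this
  exact this

lemma aeval_inv {n : ℕ} {M : Matrix (Fin (n + 1)) (Fin (n + 1)) ℝ}
    (hM : Mᵀ * Jmat n * M = Jmat n) {s : ℝ} (hs0 : s ≠ 0)
    {u : Fin (n + 1) → ℝ} (hu : u ≠ 0) (hs : M.mulVec u = s • u) :
    Polynomial.aeval ((s⁻¹ : ℝ) : ℂ) M.charpoly = 0 := by
  rw [← Matrix.charpoly_transpose]
  refine aeval_of_eig (u := (Jmat n).mulVec u) ?_ ?_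
  · intro h
    apply hu
    apply (mB_nondeg n).1
    intro y
    rw [mB_symm, mB_dot, h]; simp
  · have h := congrArg (fun N => N.mulVec u) hM
    simp only [← Matrix.mulVec_mulVec, hs, Matrix.mulVec_smul] at h
    rw [← h, smul_smul, inv_mul_cancel₀ hs0, one_smul, h]

lemma compl_of {n : ℕ} {M : Matrix (Fin (n + 1)) (Fin (n + 1)) ℝ}
    (hM : Mᵀ * Jmat n * M = Jmat n) (p S : Submodule ℝ (Fin (n + 1) → ℝ))
    (hS : ∀ v ∈ S, M.mulVec v ∈ S)
    (hdis : ∀ v ∈ p, (∀ w ∈ S, mB n w v = 0) → v = 0)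
    (hrank : Module.finrank ℝ S ≤ Module.finrank ℝ p) :
    ∃ p' : Submodule ℝ (Fin (n + 1) → ℝ), (∀ v ∈ p', M.mulVec v ∈ p') ∧ IsCompl p p' := by
  refine ⟨(mB n).orthogonal S, ?_, ?_⟩
  · intro v hv w hw
    have hinj : Function.Injective (M.mulVecLin.restrict (p := S) (q := S) hS) := by
      rw [← LinearMap.ker_eq_bot, LinearMap.ker_eq_bot']
      intro x hx
      apply Subtype.ext
      exact mulVec_inj hM (congrArg Subtype.val hx)
    obtain ⟨x, hx⟩ := LinearMap.surjective_of_injective hinj ⟨w, hw⟩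
    have hx' : M.mulVec x.1 = w := congrArg Subtype.val hx
    have : mB n w (M.mulVec v) = 0 := by
      rw [← hx', mB_isom hM]
      exact hv x.1 x.2
    exact this
  · rw [Submodule.isCompl_iff_disjoint]
    · rw [Submodule.disjoint_def]
      intro x hx hx'
      exact hdis x hx (fun w hw => hx' w hw)
    · rw [LinearMap.BilinForm.finrank_orthogonal (mB_nondeg n)]
      omega

/-- Degenerate invariant subspace containing the eigenvector `a` in its radical. -/
lemma compl_deg {n : ℕ} {M : Matrix (Fin (n + 1)) (Fin (n + 1)) ℝ}
    (hM : Mᵀ * Jmat n * M = Jmat n) {a b : Fin (n + 1) → ℝ} {β : ℝ}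
    (ha : a ≠ 0) (hqa : mB n a a = 0) (hb : M.mulVec b = β • b) (hβ : β ≠ 0)
    (hab : mB n a b ≠ 0) (p : Submodule ℝ (Fin (n + 1) → ℝ))
    (hp : ∀ v ∈ p, M.mulVec v ∈ p) (hap : a ∈ p) (hrad : ∀ w ∈ p, mB n w a = 0) :
    ∃ p' : Submodule ℝ (Fin (n + 1) → ℝ), (∀ v ∈ p', M.mulVec v ∈ p') ∧ IsCompl p p' := by
  set p1 : Submodule ℝ (Fin (n + 1) → ℝ) := p ⊓ LinearMap.ker (mB n b) with hp1
  have mem1 : ∀ v, v ∈ p1 ↔ v ∈ p ∧ mB n b v = 0 := fun v => by simp [hp1]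
  have hba : mB n b a ≠ 0 := by rwa [mB_symm]
  refine compl_of hM p (p1 ⊔ Submodule.span ℝ {b}) ?_ ?_ ?_
  · intro v hv
    obtain ⟨x, hx, y, hy, rfl⟩ := Submodule.mem_sup.mp hv
    obtain ⟨c, rfl⟩ := Submodule.mem_span_singleton.mp hy
    rw [Matrix.mulVec_add, Matrix.mulVec_smul, hb]
    refine Submodule.add_mem_sup ?_ (Submodule.smul_mem _ _ (Submodule.smul_mem _ _
      (Submodule.mem_span_singleton_self b)))
    rw [mem1] at hx ⊢
    refine ⟨hp _ hx.1, ?_⟩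
    have := mB_isom hM b x
    rw [hb, hx.2] at this
    simpa [hβ] using this
  · intro v hv hperp
    have hbv : mB n b v = 0 :=
      hperp b (Submodule.mem_sup_right (Submodule.mem_span_singleton_self b))
    have hvv : mB n v v = 0 := hperp v (Submodule.mem_sup_left ((mem1 v).2 ⟨hv, hbv⟩))
    obtain ⟨c, rfl⟩ := dep_of_isotropic' hqa ha hvv (by rw [mB_symm]; exact hrad v hv)
    have : c = 0 := by simpa [hba] using hbv
    simp [this]
  · have h1 : Module.finrank ℝ p1 < Module.finrank ℝ p := by
      apply Submodule.finrank_lt_finrank_of_lt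
      refine lt_of_le_of_ne inf_le_left (fun h => hba ?_)
      rw [← h, mem1] at hap
      exact hap.2
    have h2 := Submodule.finrank_add_le_finrank_add_finrank p1 (Submodule.span ℝ {b})
    have hb0 : b ≠ 0 := by
      rintro rfl
      simp at hab
    have h3 := finrank_span_singleton (K := ℝ) hb0
    omega

/-- Proposition 2.4, loxodromic case: a `q`-isometry preserving the future cone and
having a complex eigenvalue of modulus ≠ 1 has a real eigenvalue `λ > 1` such that
`λ`, `λ⁻¹` are simple roots of the characteristic polynomial, all other eigenvalues
have modulus 1, the eigenspaces of `λ` and `λ⁻¹` are isotropic lines, and `M` is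
semisimple. -/
theorem stmt_3 (n : ℕ) (hn : 1 ≤ n) (M : Matrix (Fin (n + 1)) (Fin (n + 1)) ℝ)
    (hM : Mᵀ * Jmat n * M = Jmat n) (hcone : PreservesFutureCone n M)
    (hbig : ∃ z : ℂ, Polynomial.aeval z M.charpoly = 0 ∧ ‖z‖ ≠ 1) :
    ∃ lam : ℝ, 1 < lam ∧
      Polynomial.rootMultiplicity lam M.charpoly = 1 ∧
      Polynomial.rootMultiplicity lam⁻¹ M.charpoly = 1 ∧
      (∀ z : ℂ, Polynomial.aeval z M.charpoly = 0 →
        z ≠ (lam : ℂ) → z ≠ ((lam⁻¹ : ℝ) : ℂ) → ‖z‖ = 1) ∧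
      Module.finrank ℝ (eigSpace n M lam) = 1 ∧
      Module.finrank ℝ (eigSpace n M lam⁻¹) = 1 ∧
      (∀ v ∈ eigSpace n M lam, qform n v = 0) ∧
      (∀ v ∈ eigSpace n M lam⁻¹, qform n v = 0) ∧
      IsSemisimpleMat n M := by
  -- the eigenvalue `lam > 1`
  obtain ⟨lam, hlam, hev⟩ :
      ∃ lam : ℝ, 1 < lam ∧ Polynomial.aeval (lam : ℂ) M.charpoly = 0 := by
    obtain ⟨z, hz, hz1⟩ := hbig
    obtain ⟨s, u, rfl, hu, hs, hq⟩ := real_eig hM hz hz1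
    have hpos := eig_pos hM hcone hu hs hq
    rcases lt_or_ge 1 s with h | h
    · exact ⟨s, h, hz⟩
    · refine ⟨s⁻¹, ?_, aeval_inv hM hpos.ne' hu hs⟩
      have : s ≠ 1 := by
        rintro rfl
        simp at hz1
      exact (one_lt_inv₀ hpos).mpr (lt_of_le_of_ne h this)
  have hl0 : 0 < lam := by linarith
  have hi0 : 0 < lam⁻¹ := inv_pos.mpr hl0
  have hi1 : lam⁻¹ < 1 := inv_lt_one_of_one_lt₀ hlam
  obtain ⟨a, ha, hMa, hqa⟩ : ∃ a : Fin (n + 1) → ℝ, a ≠ 0 ∧ M.mulVec a = lam • a ∧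
      mB n a a = 0 := by
    obtain ⟨s, u, hs, hu, hMu, hq⟩ := real_eig hM hev (by
      rw [Complex.norm_real, Real.norm_of_nonneg hl0.le]; exact hlam.ne')
    rw [← Complex.ofReal_injective hs] at hMu
    exact ⟨u, hu, hMu, hq⟩
  obtain ⟨b, hb, hMb, hqb⟩ : ∃ b : Fin (n + 1) → ℝ, b ≠ 0 ∧ M.mulVec b = lam⁻¹ • b ∧
      mB n b b = 0 := by
    obtain ⟨s, u, hs, hu, hMu, hq⟩ := real_eig hM (aeval_inv hM hl0.ne' ha hMa) (by
      rw [Complex.norm_real, Real.norm_of_nonneg hi0.le]; exact hi1.ne)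
    rw [← Complex.ofReal_injective hs] at hMu
    exact ⟨u, hu, hMu, hq⟩
  -- two isotropic eigenvectors are proportional, or their eigenvalues are inverse
  have orth : ∀ (s t : ℝ) (x y : Fin (n + 1) → ℝ), M.mulVec x = s • x → M.mulVec y = t • y →
      s * t ≠ 1 → mB n x y = 0 := by
    intro s t x y hx hy hst
    have := mB_isom hM x y
    rw [hx, hy] at this
    simp only [map_smul, LinearMap.smul_apply, smul_eq_mul] at this
    have h : (s * t - 1) * mB n x y = 0 := by linear_combination this
    exact (mul_eq_zero.mp h).resolve_left (sub_ne_zero.mpr hst)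
  have same : ∀ (s t c : ℝ) (x y : Fin (n + 1) → ℝ), M.mulVec x = s • x → M.mulVec y = t • y →
      y ≠ 0 → y = c • x → t = s := by
    rintro s t c x y hx hy hy0 rfl
    rw [Matrix.mulVec_smul, hx, smul_comm] at hy
    have : (s - t) • (c • x) = 0 := by rw [sub_smul, hy, sub_self]
    have := (smul_eq_zero.mp this).resolve_right hy0
    linarith
  have hne : lam ≠ lam⁻¹ := by linarith
  have hab : mB n a b ≠ 0 := by
    intro h
    obtain ⟨c, hc⟩ := dep_of_isotropic' hqa ha hqb h
    exact hne (same _ _ _ _ _ hMa hMb hb hc).symm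
  have hba : mB n b a ≠ 0 := by rwa [mB_symm]
  -- isotropic eigenvectors
  have class_iso : ∀ (s : ℝ) (x : Fin (n + 1) → ℝ), M.mulVec x = s • x → x ≠ 0 →
      mB n x x = 0 → (∃ c : ℝ, x = c • a) ∨ (∃ c : ℝ, x = c • b) := by
    intro s x hx hx0 hq
    by_cases h : lam * s = 1
    · right
      have hs : s = lam⁻¹ := eq_inv_of_mul_eq_one_right h
      refine dep_of_isotropic' hqb hb hq (orth _ _ _ _ hMb hx ?_)
      rw [hs]; nlinarith
    · left
      exact dep_of_isotropic' hqa ha hq (orth _ _ _ _ hMa hx h)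
  have memeig : ∀ (s : ℝ) (x : Fin (n + 1) → ℝ), x ∈ eigSpace n M s ↔ M.mulVec x = s • x := by
    intro s x
    simp [eigSpace, sub_eq_zero]
  have isoA : ∀ v ∈ eigSpace n M lam, mB n v v = 0 := by
    intro v hv
    rw [memeig] at hv
    exact orth _ _ _ _ hv hv (by nlinarith)
  have isoB : ∀ v ∈ eigSpace n M lam⁻¹, mB n v v = 0 := by
    intro v hv
    rw [memeig] at hv
    exact orth _ _ _ _ hv hv (by nlinarith)
  have spanA : eigSpace n M lam = Submodule.span ℝ {a} := by
    apply le_antisymm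
    · intro v hv
      obtain ⟨c, hc⟩ := dep_of_isotropic' hqa ha (isoA v hv)
        (orth _ _ _ _ hMa ((memeig _ _).1 hv) (by nlinarith))
      exact Submodule.mem_span_singleton.mpr ⟨c, hc.symm⟩
    · rw [Submodule.span_singleton_le_iff_mem, memeig]
      exact hMa
  have spanB : eigSpace n M lam⁻¹ = Submodule.span ℝ {b} := by
    apply le_antisymm
    · intro v hv
      obtain ⟨c, hc⟩ := dep_of_isotropic' hqb hb (isoB v hv)
        (orth _ _ _ _ hMb ((memeig _ _).1 hv) (by nlinarith))
      exact Submodule.mem_span_singleton.mpr ⟨c, hc.symm⟩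
    · rw [Submodule.span_singleton_le_iff_mem, memeig]
      exact hMb
  have rankA : Module.finrank ℝ (eigSpace n M lam) = 1 := by
    rw [spanA]; exact finrank_span_singleton ha
  have rankB : Module.finrank ℝ (eigSpace n M lam⁻¹) = 1 := by
    rw [spanB]; exact finrank_span_singleton hb
  have hss : IsSemisimpleMat n M := by
    intro p hp
    by_cases hrad : ∀ v ∈ p, (∀ w ∈ p, mB n w v = 0) → v = 0
    · exact compl_of hM p p hp hrad le_rfl
    · push Not at hrad
      obtain ⟨v, hv, hvp, hv0⟩ := hrad
      have hMvp : mB n v (M.mulVec v) = 0 := by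
        rw [mB_symm]; exact hvp _ (hp v hv)
      have hvv := hvp v hv
      obtain ⟨s, hs⟩ := dep_of_isotropic' hvv hv0 (by rw [mB_isom hM]; exact hvv) hMvp
      rcases class_iso s v hs hv0 hvv with ⟨c, rfl⟩ | ⟨c, rfl⟩
      · have hc : c ≠ 0 := by rintro rfl; simp at hv0
        refine compl_deg hM ha hqa hMb hi0.ne' hab p hp ((p.smul_mem_iff hc).1 hv) ?_
        intro w hw
        simpa [hc] using hvp w hw
      · have hc : c ≠ 0 := by rintro rfl; simp at hv0
        refine compl_deg hM hb hqb hMa hl0.ne' hba p hp ((p.smul_mem_iff hc).1 hv) ?_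
        intro w hw
        simpa [hc] using hvp w hw
  have mult : ∀ s : ℝ, Polynomial.rootMultiplicity s M.charpoly =
      Module.finrank ℝ (eigSpace n M s) := by
    intro s
    have hss' : Module.End.IsSemisimple (Matrix.toLin' M) := by
      rw [Module.End.isSemisimple_iff]
      intro p hp
      obtain ⟨p', hp', hc⟩ := hss p (fun v hv => by simpa using hp hv)
      exact ⟨p', fun v hv => by simpa using hp' v hv, hc⟩
    have he : eigSpace n M s = Module.End.eigenspace (Matrix.toLin' M) s := by
      ext x
      rw [memeig, Module.End.mem_eigenspace_iff, Matrix.toLin'_apply]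
    rw [he, ← (Module.End.isFinitelySemisimple_iff_isSemisimple.mpr
      hss').maxGenEigenspace_eq_eigenspace, LinearMap.finrank_maxGenEigenspace_eq,
      Matrix.charpoly_toLin']
  refine ⟨lam, hlam, by rw [mult, rankA], by rw [mult, rankB], ?_, rankA, rankB,
    fun v hv => by rw [qform_eq]; exact isoA v hv,
    fun v hv => by rw [qform_eq]; exact isoB v hv, hss⟩
  intro z hz hz1 hz2
  by_contra hz3
  obtain ⟨s, u, rfl, hu, hMu, hq⟩ := real_eig hM hz hz3
  rcases class_iso s u hMu hu hq with ⟨c, hc⟩ | ⟨c, hc⟩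
  · exact hz1 (by rw [same _ _ _ _ _ hMa hMu hu hc])
  · exact hz2 (by rw [same _ _ _ _ _ hMb hMu hu hc])
end
end

section
/- Let M be a q-isometry (Mᵀ J M = J) that preserves the future cone, such that every complex eigenvalue of M has modulus 1 and M is not semisimple (i.e. M is of parabolic type). Then there exist linearly independent vectors v₀, v₁, v₂ ∈ ℝ^{n+1} with M v₀ = v₀, M v₁ = v₁ + v₀ and M v₂ = v₂ + v₁ (so M acts on F = span(v₀, v₁, v₂) as a single 3×3 Jordan block with eigenvalue 1), satisfying q(v₀) = 0, ⟨v₀, v₁⟩ = 0 and q(v₂) = 1; moreover the restriction of q to F is nondegenerate of signature (1, 2) and q is negative definite on the J-orthogonal complement of F, so that ℝ^{n+1} = F ⊕ F^⊥. -/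
open Matrix

noncomputable section

/-- The polar bilinear form `⟨v, w⟩ = vᵀ J w`. -/
def bform (n : ℕ) (v w : Fin (n + 1) → ℝ) : ℝ := v ⬝ᵥ (Jmat n).mulVec w

/-- The `J`-orthogonal complement of a subspace `F` of `ℝ^{n+1}`. -/
def perpOf (n : ℕ) (F : Submodule ℝ (Fin (n + 1) → ℝ)) : Submodule ℝ (Fin (n + 1) → ℝ) where
  carrier := {v | ∀ w ∈ F, bform n v w = 0}
  zero_mem' := fun w _ => by simp [bform]
  add_mem' := by
    intro a b ha hb w hw
    have h1 := ha w hw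
    have h2 := hb w hw
    simp only [bform] at h1 h2 ⊢
    rw [add_dotProduct, h1, h2, add_zero]
  smul_mem' := by
    intro c a ha w hw
    have h1 := ha w hw
    simp only [bform] at h1 ⊢
    rw [smul_dotProduct, h1, smul_zero]

section helpers

theorem h_bform_expand (n : ℕ) (v w : Fin (n + 1) → ℝ) :
    bform n v w = v 0 * w 0 - ∑ i : Fin n, v i.succ * w i.succ := by
  simp [bform, Jmat, dotProduct, mulVec_diagonal, Fin.sum_univ_succ, Finset.sum_neg_distrib]
  ring

theorem h_qb (n : ℕ) (v : Fin (n + 1) → ℝ) : qform n v = bform n v v := rfl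

theorem h_add_left (n : ℕ) (u v w : Fin (n + 1) → ℝ) :
    bform n (u + v) w = bform n u w + bform n v w := by simp [bform]

theorem h_add_right (n : ℕ) (u v w : Fin (n + 1) → ℝ) :
    bform n u (v + w) = bform n u v + bform n u w := by simp [bform, mulVec_add]

theorem h_sub_left (n : ℕ) (u v w : Fin (n + 1) → ℝ) :
    bform n (u - v) w = bform n u w - bform n v w := by simp [bform]

theorem h_sub_right (n : ℕ) (u v w : Fin (n + 1) → ℝ) :
    bform n u (v - w) = bform n u v - bform n u w := by simp [bform, mulVec_sub]

theorem h_smul_left (n : ℕ) (c : ℝ) (u v : Fin (n + 1) → ℝ) :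
    bform n (c • u) v = c * bform n u v := by simp [bform]

theorem h_smul_right (n : ℕ) (c : ℝ) (u v : Fin (n + 1) → ℝ) :
    bform n u (c • v) = c * bform n u v := by simp [bform, mulVec_smul]

theorem h_zero_left (n : ℕ) (v : Fin (n + 1) → ℝ) : bform n 0 v = 0 := by simp [bform]

theorem h_comm (n : ℕ) (u v : Fin (n + 1) → ℝ) : bform n u v = bform n v u := by
  rw [h_bform_expand, h_bform_expand]
  congr 1
  · ring
  · exact Finset.sum_congr rfl fun i _ => mul_comm _ _

/-- The form as a Mathlib bilinear form. -/
def hB (n : ℕ) : LinearMap.BilinForm ℝ (Fin (n + 1) → ℝ) :=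
  LinearMap.mk₂ ℝ (bform n) (h_add_left n) (h_smul_left n) (h_add_right n) (h_smul_right n)

theorem h_time (n : ℕ) (z x : Fin (n + 1) → ℝ) (hz : 0 < bform n z z) (hxz : bform n x z = 0)
    (hx : x ≠ 0) : bform n x x < 0 := by
  by_contra! hc
  rw [h_bform_expand] at hz hxz hc
  have cs := Finset.sum_mul_sq_le_sq_mul_sq Finset.univ
    (fun i : Fin n => x i.succ) (fun i : Fin n => z i.succ)
  have e1 : ∑ i : Fin n, x i.succ * x i.succ = ∑ i : Fin n, x i.succ ^ 2 :=
    Finset.sum_congr rfl fun i _ => by ring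
  have e2 : ∑ i : Fin n, z i.succ * z i.succ = ∑ i : Fin n, z i.succ ^ 2 :=
    Finset.sum_congr rfl fun i _ => by ring
  rw [e1] at hc
  rw [e2] at hz
  have p1 : 0 ≤ ∑ i : Fin n, x i.succ ^ 2 := Finset.sum_nonneg fun i _ => sq_nonneg _
  have p2 : 0 ≤ ∑ i : Fin n, z i.succ ^ 2 := Finset.sum_nonneg fun i _ => sq_nonneg _
  have e3 : ∑ i : Fin n, x i.succ * z i.succ = x 0 * z 0 := by linarith
  rw [e3] at cs
  rcases p1.eq_or_lt with h | h
  · apply hx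
    rw [← h] at cs
    have z0 : z 0 ≠ 0 := by
      intro h0
      rw [h0] at hz
      linarith
    have x0 : x 0 = 0 := by
      have : (x 0 * z 0) = 0 := by nlinarith
      exact (mul_eq_zero.mp this).resolve_right z0
    have hh := (Finset.sum_eq_zero_iff_of_nonneg (fun i _ => sq_nonneg _)).mp h.symm
    funext i
    refine Fin.cases x0 (fun j => ?_) i
    simpa using hh j (Finset.mem_univ _)
  · have z0 : 0 ≤ z 0 * z 0 := mul_self_nonneg _
    have a1 := mul_lt_mul_of_pos_left (sub_pos.mp hz) h
    have a2 := mul_le_mul_of_nonneg_right (sub_nonneg.mp hc) z0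
    nlinarith

theorem h_time0 (n : ℕ) (v : Fin (n + 1) → ℝ) (h0 : v 0 = 0) (hv : 0 ≤ bform n v v) : v = 0 := by
  rw [h_bform_expand, h0] at hv
  have h : ∑ i : Fin n, v i.succ * v i.succ = 0 :=
    le_antisymm (by linarith) (Finset.sum_nonneg fun i _ => mul_self_nonneg _)
  have hh := (Finset.sum_eq_zero_iff_of_nonneg (fun i _ => mul_self_nonneg _)).mp h
  funext i
  refine Fin.cases h0 (fun j => ?_) i
  simpa using hh j (Finset.mem_univ _)

theorem h_null (n : ℕ) (v x : Fin (n + 1) → ℝ) (hv : v ≠ 0) (hq : bform n v v = 0)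
    (hxv : bform n x v = 0) (hx : 0 ≤ bform n x x) : ∃ c : ℝ, x = c • v := by
  have hv0 : v 0 ≠ 0 := fun h => hv (h_time0 n v h hq.ge)
  refine ⟨x 0 / v 0, sub_eq_zero.mp (h_time0 n _ ?_ ?_)⟩
  · simp [hv0]
  · simp only [h_sub_left, h_sub_right, h_smul_left, h_smul_right, h_comm n v x, hxv, hq]
    linarith

theorem h_iso (n : ℕ) (M : Matrix (Fin (n + 1)) (Fin (n + 1)) ℝ)
    (hM : Mᵀ * Jmat n * M = Jmat n) (x y : Fin (n + 1) → ℝ) :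
    bform n (M.mulVec x) (M.mulVec y) = bform n x y := by
  unfold bform
  conv_rhs => rw [← hM]
  rw [← vecMul_transpose, ← dotProduct_mulVec, mulVec_mulVec, mulVec_mulVec, Matrix.mul_assoc]

theorem h_inj (n : ℕ) (M : Matrix (Fin (n + 1)) (Fin (n + 1)) ℝ)
    (hM : Mᵀ * Jmat n * M = Jmat n) : Function.Injective (toLin' M) := by
  rw [injective_iff_map_eq_zero]
  intro x hx
  rw [toLin'_apply] at hx
  have h : ∀ y, bform n x y = 0 := fun y => by rw [← h_iso n M hM, hx, h_zero_left]
  apply h_time0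
  · have := h (Pi.single 0 1)
    rw [h_bform_expand] at this
    simpa using this
  · exact (h x).ge

theorem h_map (n : ℕ) (M : Matrix (Fin (n + 1)) (Fin (n + 1)) ℝ)
    (hM : Mᵀ * Jmat n * M = Jmat n) (p : Submodule ℝ (Fin (n + 1) → ℝ))
    (hp : ∀ v ∈ p, M.mulVec v ∈ p) : ∀ w ∈ p, ∃ w' ∈ p, M.mulVec w' = w := by
  have h1 : p.map (toLin' M) ≤ p := by
    rintro _ ⟨v, hv, rfl⟩
    simpa using hp v hv
  have h2 := Submodule.eq_of_le_of_finrank_eq h1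
    ((Submodule.equivMapOfInjective _ (h_inj n M hM) p).finrank_eq.symm)
  intro w hw
  rw [← h2] at hw
  obtain ⟨v, hv, h⟩ := hw
  exact ⟨v, hv, by simpa using h⟩

theorem h_compl (n : ℕ) (M : Matrix (Fin (n + 1)) (Fin (n + 1)) ℝ)
    (hM : Mᵀ * Jmat n * M = Jmat n) (p : Submodule ℝ (Fin (n + 1) → ℝ))
    (hp : ∀ v ∈ p, M.mulVec v ∈ p) (B : LinearMap.BilinForm ℝ (Fin (n + 1) → ℝ))
    (hs : ∀ x y, B x y = B y x) (hB : ∀ x y, B (M.mulVec x) (M.mulVec y) = B x y)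
    (hd : ∀ x ∈ p, (∀ y ∈ p, B y x = 0) → x = 0) :
    ∃ p' : Submodule ℝ (Fin (n + 1) → ℝ), (∀ v ∈ p', M.mulVec v ∈ p') ∧ IsCompl p p' := by
  refine ⟨B.orthogonal p, ?_, ?_⟩
  · intro v hv w hw
    obtain ⟨w', hw', rfl⟩ := h_map n M hM p hp w hw
    have h : B w' v = 0 := hv w' hw'
    change B (M.mulVec w') (M.mulVec v) = 0
    rw [hB, h]
  · rw [LinearMap.BilinForm.isCompl_orthogonal_iff_disjoint]
    · rw [Submodule.disjoint_def]
      intro x hx hx'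
      exact hd x hx fun y hy => hx' y hy
    · intro x y h
      rw [hs, h]

theorem h_fixtime (n : ℕ) (M : Matrix (Fin (n + 1)) (Fin (n + 1)) ℝ)
    (hM : Mᵀ * Jmat n * M = Jmat n) (z : Fin (n + 1) → ℝ) (hz : 0 < bform n z z)
    (hMz : M.mulVec z = z) : IsSemisimpleMat n M := by
  intro p hp
  let B : LinearMap.BilinForm ℝ (Fin (n + 1) → ℝ) :=
    LinearMap.mk₂ ℝ (fun x y => 2 * bform n x z * bform n y z - bform n z z * bform n x y)
      (by intro a b c; simp only [h_add_left]; ring)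
      (by intro a b c; simp only [h_smul_left, smul_eq_mul]; ring)
      (by intro a b c; simp only [h_add_left, h_add_right]; ring)
      (by intro a b c; simp only [h_smul_left, h_smul_right, smul_eq_mul]; ring)
  have hB : ∀ x y, B x y = 2 * bform n x z * bform n y z - bform n z z * bform n x y :=
    fun _ _ => rfl
  refine h_compl n M hM p hp B ?_ ?_ ?_
  · intro x y
    rw [hB, hB, h_comm n x y]; ring
  · intro x y
    have h : ∀ x, bform n (M.mulVec x) z = bform n x z := fun x => by
      conv_lhs => rw [← hMz]
      exact h_iso n M hM x z
    rw [hB, hB, h_iso n M hM, h, h]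
  · intro x hx h
    have h := h x hx
    rw [hB] at h
    by_contra hne
    set c := bform n x z / bform n z z with hc
    have hcz : bform n x z = c * bform n z z := by rw [hc]; field_simp
    have e1 : bform n (x - c • z) z = 0 := by
      rw [h_sub_left, h_smul_left, hcz]; ring
    have e2 : bform n (x - c • z) (x - c • z) = bform n x x - c ^ 2 * bform n z z := by
      simp only [h_sub_left, h_sub_right, h_smul_left, h_smul_right, h_comm n z x, hcz]; ring
    rw [hcz] at h
    have h3 : bform n x x = 2 * c ^ 2 * bform n z z := by
      have : bform n z z * (2 * c ^ 2 * bform n z z - bform n x x) = 0 := by linarith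
      have := (mul_eq_zero.mp this).resolve_left hz.ne'
      linarith
    by_cases h0 : x - c • z = 0
    · rw [h0, h_zero_left] at e2
      have : c ^ 2 * bform n z z = 0 := by linarith
      have := (mul_eq_zero.mp this).resolve_right hz.ne'
      have : c = 0 := by simpa using this
      apply hne
      simpa [this] using h0
    · have := h_time n z _ hz e1 h0
      have : 0 ≤ c ^ 2 * bform n z z := by positivity
      linarith

/-- A null fixed vector. -/
theorem h_fixnull (n : ℕ) (M : Matrix (Fin (n + 1)) (Fin (n + 1)) ℝ)
    (hM : Mᵀ * Jmat n * M = Jmat n) (hcone : PreservesFutureCone n M)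
    (hmod : ∀ z : ℂ, Polynomial.aeval z M.charpoly = 0 → ‖z‖ = 1)
    (hnss : ¬ IsSemisimpleMat n M) :
    ∃ v : Fin (n + 1) → ℝ, v ≠ 0 ∧ bform n v v = 0 ∧ M.mulVec v = v := by
  unfold IsSemisimpleMat at hnss
  push Not at hnss
  obtain ⟨p, hp, hno⟩ := hnss
  have h1 : ∃ x ∈ p, (∀ y ∈ p, bform n y x = 0) ∧ x ≠ 0 := by
    by_contra! hc
    obtain ⟨p', h, h'⟩ := h_compl n M hM p hp (hB n) (h_comm n) (h_iso n M hM) hc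
    exact hno p' h h'
  obtain ⟨x, hx, hxp, hx0⟩ := h1
  have hq := hxp x hx
  obtain ⟨c, hc⟩ := h_null n x (M.mulVec x) hx0 hq (hxp _ (hp x hx))
    (by rw [h_iso n M hM, hq])
  have habs : |c| = 1 := by
    have hev : Module.End.HasEigenvalue (toLin' M) c :=
      Module.End.hasEigenvalue_of_hasEigenvector
        ⟨Module.End.mem_eigenspace_iff.mpr (by simpa using hc), hx0⟩
    rw [Module.End.hasEigenvalue_iff_isRoot_charpoly, Matrix.charpoly_toLin'] at hev
    have := hmod (algebraMap ℝ ℂ c) (by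
      rw [Polynomial.aeval_algebraMap_apply, Polynomial.aeval_def, Algebra.algebraMap_self,
        Polynomial.eval₂_id, hev.eq_zero, map_zero])
    simpa using this
  refine ⟨x, hx0, hq, ?_⟩
  rcases (abs_eq zero_le_one).mp habs with h | h
  · rw [hc, h, one_smul]
  · exfalso
    rw [h] at hc
    have key : ∀ v : Fin (n + 1) → ℝ, 0 < v 0 → bform n v v = 0 → M.mulVec v = (-1 : ℝ) • v →
        False := by
      intro v hv hvq hvM
      set e : Fin (n + 1) → ℝ := Pi.single 0 1 with he
      have e0 : e 0 = 1 := by simp [he]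
      have ee : bform n e e = 1 := by rw [h_bform_expand]; simp [he]
      have ev : bform n e v = v 0 := by rw [h_bform_expand]; simp [he]
      set t := (|M.mulVec e 0| + 1) / v 0 with ht
      have htp : 0 < t := by positivity
      have htv : t * v 0 = |M.mulVec e 0| + 1 := by rw [ht]; field_simp
      have := (hcone (e + t • v) ?_ ?_).2
      · rw [mulVec_add, mulVec_smul, hvM] at this
        simp at this
        have := le_abs_self (M.mulVec e 0)
        linarith
      · simp only [h_qb, h_add_left, h_add_right, h_smul_left, h_smul_right, h_comm n v e, ee, ev,
          hvq]
        nlinarith [mul_pos htp hv]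
      · simp only [Pi.add_apply, Pi.smul_apply, smul_eq_mul, e0]
        nlinarith [mul_pos htp hv]
    have hx00 : x 0 ≠ 0 := fun h => hx0 (h_time0 n x h hq.ge)
    rcases lt_or_gt_of_ne hx00 with h0 | h0
    · refine key ((-1 : ℝ) • x) (by simpa using h0) ?_ ?_
      · rw [h_smul_left, h_smul_right, hq]; simp
      · rw [mulVec_smul, hc]
    · exact key x h0 hq hc

/-- The Jordan chain. -/
theorem h_chain (n : ℕ) (M : Matrix (Fin (n + 1)) (Fin (n + 1)) ℝ)
    (hM : Mᵀ * Jmat n * M = Jmat n) (hnss : ¬ IsSemisimpleMat n M)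
    (v : Fin (n + 1) → ℝ) (hv : v ≠ 0) (hq : bform n v v = 0) (hMv : M.mulVec v = v) :
    ∃ u y : Fin (n + 1) → ℝ, ∃ a : ℝ, a ≠ 0 ∧ bform n u v ≠ 0 ∧
      M.mulVec u = u + y ∧ M.mulVec y = y + a • v := by
  set N : (Fin (n + 1) → ℝ) →ₗ[ℝ] (Fin (n + 1) → ℝ) := toLin' M - 1 with hN
  have hMN : ∀ x, M.mulVec x = x + N x := fun x => by simp [hN]
  have hbv : ∀ x, bform n (M.mulVec x) v = bform n x v := fun x => by
    conv_lhs => rw [← hMv]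
    exact h_iso n M hM x v
  have hNv : ∀ x, bform n (N x) v = 0 := fun x => by
    have := hbv x
    rw [hMN, h_add_left] at this
    linarith
  -- Fitting decomposition
  obtain ⟨k, hk⟩ := Filter.eventually_atTop.mp (LinearMap.eventually_isCompl_ker_pow_range_pow N)
  have hk := hk (k + 1) (by omega)
  have hu : ∃ u, (N ^ (k + 1)) u = 0 ∧ bform n u v ≠ 0 := by
    by_contra! hc
    have hall : ∀ x, bform n x v = 0 := by
      intro x
      have hx : x ∈ LinearMap.ker (N ^ (k + 1)) ⊔ LinearMap.range (N ^ (k + 1)) := by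
        rw [hk.sup_eq_top]; trivial
      obtain ⟨a, ha, _, ⟨b, rfl⟩, rfl⟩ := Submodule.mem_sup.mp hx
      rw [h_add_left, hc a ha, pow_succ', Module.End.mul_apply, hNv, add_zero]
    apply hv
    apply h_time0
    · have := hall (Pi.single 0 1)
      rw [h_bform_expand] at this
      simpa using this
    · exact hq.ge
  obtain ⟨u, hu, huv⟩ := hu
  have step : ∀ x, bform n x v = 0 → (∃ a : ℝ, N (N x) = a • v) → ∃ a : ℝ, N x = a • v := by
    rintro x hx ⟨a, ha⟩
    refine h_null n v (N x) hv hq (hNv x) ?_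
    have := h_iso n M hM (N x) x
    rw [hMN (N x), hMN x, ha] at this
    simp only [h_add_left, h_add_right, h_smul_left, h_comm n v, hx, hNv] at this
    linarith
  have desc : ∀ j : ℕ, ∀ x, bform n x v = 0 → (N ^ j) x = 0 → ∃ a : ℝ, N x = a • v := by
    intro j
    induction j with
    | zero =>
      intro x _ h
      refine ⟨0, ?_⟩
      have : x = 0 := by simpa using h
      simp [this]
    | succ j ih =>
      intro x hx h
      rw [pow_succ, Module.End.mul_apply] at h
      exact step x hx (ih (N x) (hNv x) h)
  rw [pow_succ, Module.End.mul_apply] at hu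
  obtain ⟨a, ha⟩ := desc k (N u) (hNv u) hu
  refine ⟨u, N u, a, ?_, huv, hMN u, by rw [hMN, ha]⟩
  rintro rfl
  rw [zero_smul] at ha
  have h1 : bform n (N u) (N u) = 0 := by
    have := h_iso n M hM (N u) u
    rw [hMN (N u), hMN u, ha, add_zero, h_add_right] at this
    linarith
  obtain ⟨c, hc⟩ := h_null n v (N u) hv hq (hNv u) h1.ge
  have h2 : c = 0 := by
    have := h_iso n M hM u u
    rw [hMN u, hc] at this
    simp only [h_add_left, h_add_right, h_smul_left, h_smul_right, h_comm n v u, hq] at this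
    have : c * bform n u v = 0 := by linarith
    exact (mul_eq_zero.mp this).resolve_right huv
  have hMu : M.mulVec u = u := by rw [hMN, hc, h2]; simp
  apply hnss
  refine h_fixtime n M hM (u + ((1 - bform n u u) / (2 * bform n u v)) • v) ?_ ?_
  · simp only [h_add_left, h_add_right, h_smul_left, h_smul_right, h_comm n v u, hq]
    have : (1 - bform n u u) / (2 * bform n u v) * bform n u v = (1 - bform n u u) / 2 := by
      field_simp
    simp only [mul_zero, add_zero, this]
    linarith
  · rw [mulVec_add, mulVec_smul, hMu, hMv]

end helpers

/-- Proposition 2.6, items (1)–(4): a parabolic `q`-isometry (future-cone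
preserving, all complex eigenvalues of modulus 1, not semisimple) acts as a single
3×3 Jordan block with eigenvalue 1 on a 3-dimensional invariant subspace `F` with
`q|F` nondegenerate of signature `(1,2)`, and `q` is negative definite on `F^⊥`,
with `ℝ^{n+1} = F ⊕ F^⊥`. -/
theorem stmt_5 (n : ℕ) (hn : 1 ≤ n) (M : Matrix (Fin (n + 1)) (Fin (n + 1)) ℝ)
    (hM : Mᵀ * Jmat n * M = Jmat n) (hcone : PreservesFutureCone n M)
    (hmod : ∀ z : ℂ, Polynomial.aeval z M.charpoly = 0 → ‖z‖ = 1)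
    (hnss : ¬ IsSemisimpleMat n M) :
    ∃ v₀ v₁ v₂ : Fin (n + 1) → ℝ,
      LinearIndependent ℝ ![v₀, v₁, v₂] ∧
      M.mulVec v₀ = v₀ ∧
      M.mulVec v₁ = v₁ + v₀ ∧
      M.mulVec v₂ = v₂ + v₁ ∧
      qform n v₀ = 0 ∧ bform n v₀ v₁ = 0 ∧ qform n v₂ = 1 ∧
      -- the restriction of `q` to `F = span(v₀, v₁, v₂)` is nondegenerate of
      -- signature (1,2): there is an orthogonal basis of `F` with signs (+,-,-)
      (∃ w₀ w₁ w₂ : Fin (n + 1) → ℝ,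
        Submodule.span ℝ {w₀, w₁, w₂} = Submodule.span ℝ {v₀, v₁, v₂} ∧
        bform n w₀ w₁ = 0 ∧ bform n w₀ w₂ = 0 ∧ bform n w₁ w₂ = 0 ∧
        qform n w₀ = 1 ∧ qform n w₁ = -1 ∧ qform n w₂ = -1) ∧
      -- `q` is negative definite on `F^⊥`
      (∀ v ∈ perpOf n (Submodule.span ℝ {v₀, v₁, v₂}), v ≠ 0 → qform n v < 0) ∧
      -- `ℝ^{n+1} = F ⊕ F^⊥`
      IsCompl (Submodule.span ℝ {v₀, v₁, v₂})
        (perpOf n (Submodule.span ℝ {v₀, v₁, v₂})) := by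
  obtain ⟨v, hv, hq, hMv⟩ := h_fixnull n M hM hcone hmod hnss
  obtain ⟨u, y, a, ha, huv, hMu, hMy⟩ := h_chain n M hM hnss v hv hq hMv
  -- Rename the chain.
  obtain ⟨v₀, h0⟩ : ∃ v₀, v₀ = a • v := ⟨_, rfl⟩
  have hv0 : v₀ ≠ 0 := by rw [h0]; exact smul_ne_zero ha hv
  have q0 : bform n v₀ v₀ = 0 := by rw [h0, h_smul_left, h_smul_right, hq]; simp
  have M0 : M.mulVec v₀ = v₀ := by rw [h0, mulVec_smul, hMv]
  rw [← h0] at hMy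
  have huv0 : bform n v₀ u ≠ 0 := by
    rw [h0, h_smul_left, h_comm]; exact mul_ne_zero ha huv
  have b01 : bform n v₀ y = 0 := by
    have := h_iso n M hM v₀ u
    rw [M0, hMu, h_add_right] at this
    linarith
  have b11 : bform n y y = - bform n v₀ u := by
    have := h_iso n M hM y u
    rw [hMu, hMy] at this
    simp only [h_add_left, h_add_right, b01] at this
    linarith
  have b12 : bform n y u = bform n v₀ u / 2 := by
    have := h_iso n M hM u u
    rw [hMu] at this
    simp only [h_add_left, h_add_right, h_comm n u y] at this
    linarith
  have hβ : 0 < bform n v₀ u := by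
    by_contra! hc
    obtain ⟨c, hc⟩ := h_null n v₀ y hv0 q0 (by rw [h_comm, b01]) (by linarith)
    rw [hc, h_smul_left, h_smul_right, q0] at b11
    apply huv0
    linarith
  obtain ⟨β, hβd⟩ : ∃ β, β = bform n v₀ u := ⟨_, rfl⟩
  rw [← hβd] at hβ b11 b12
  obtain ⟨v₂, h2⟩ : ∃ v₂, v₂ = u + ((1 - bform n u u) / (2 * β)) • v₀ := ⟨_, rfl⟩
  have b02 : bform n v₀ v₂ = β := by
    rw [h2, h_add_right, h_smul_right, q0, hβd]; simp
  have b12' : bform n y v₂ = β / 2 := by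
    rw [h2, h_add_right, h_smul_right, b12, h_comm n y v₀, b01]; simp
  have b22 : bform n v₂ v₂ = 1 := by
    rw [h2]
    simp only [h_add_left, h_add_right, h_smul_left, h_smul_right, h_comm n u v₀, q0, ← hβd]
    field_simp
    ring
  have M2 : M.mulVec v₂ = v₂ + y := by
    rw [h2, mulVec_add, mulVec_smul, M0, hMu]; abel
  have b10 : bform n y v₀ = 0 := by rw [h_comm, b01]
  have b20 : bform n v₂ v₀ = β := by rw [h_comm, b02]
  have b21 : bform n v₂ y = β / 2 := by rw [h_comm, b12']
  have hs : 0 < √β := Real.sqrt_pos.mpr hβ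
  have hss : √β * √β = β := Real.mul_self_sqrt hβ.le
  obtain ⟨s, hsd⟩ : ∃ s, s = √β := ⟨_, rfl⟩
  rw [← hsd] at hs hss
  obtain ⟨w₁, hw1⟩ : ∃ w, w = β⁻¹ • v₀ - v₂ := ⟨_, rfl⟩
  obtain ⟨w₂, hw2⟩ : ∃ w, w = s⁻¹ • (y - (1 / 2 : ℝ) • v₀) := ⟨_, rfl⟩
  have c01 : bform n v₂ w₁ = 0 := by
    rw [hw1]
    simp only [h_sub_right, h_smul_right, b20, b22]
    field_simp; ring
  have c02 : bform n v₂ w₂ = 0 := by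
    rw [hw2]
    simp only [h_sub_right, h_smul_right, b20, b21]
    ring
  have c12 : bform n w₁ w₂ = 0 := by
    rw [hw1, hw2]
    simp only [h_sub_right, h_sub_left, h_smul_left, h_smul_right, b20, b21, b01, q0]
    ring
  have c11 : bform n w₁ w₁ = -1 := by
    rw [hw1]
    simp only [h_sub_right, h_sub_left, h_smul_left, h_smul_right, b20, b02, q0, b22]
    field_simp; ring
  have c22 : bform n w₂ w₂ = -1 := by
    rw [hw2]
    simp only [h_sub_right, h_sub_left, h_smul_left, h_smul_right, b01, b10, q0, b11, ← hss]
    field_simp; ring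
  have e0 : v₀ = β • w₁ + β • v₂ := by
    rw [hw1, smul_sub, smul_smul, mul_inv_cancel₀ hβ.ne', one_smul]; abel
  have e1 : y = s • w₂ + (1 / 2 : ℝ) • v₀ := by
    rw [hw2, smul_smul, mul_inv_cancel₀ hs.ne', one_smul]; abel
  have m0 : v₀ ∈ Submodule.span ℝ {v₀, y, v₂} := Submodule.subset_span (by simp)
  have m1 : y ∈ Submodule.span ℝ {v₀, y, v₂} := Submodule.subset_span (by simp)
  have m2 : v₂ ∈ Submodule.span ℝ {v₀, y, v₂} := Submodule.subset_span (by simp)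
  have mw1 : w₁ ∈ Submodule.span ℝ {v₀, y, v₂} := by
    rw [hw1]; exact sub_mem (Submodule.smul_mem _ _ m0) m2
  have mw2 : w₂ ∈ Submodule.span ℝ {v₀, y, v₂} := by
    rw [hw2]; exact Submodule.smul_mem _ _ (sub_mem m1 (Submodule.smul_mem _ _ m0))
  have hspan : Submodule.span ℝ {v₂, w₁, w₂} = Submodule.span ℝ {v₀, y, v₂} := by
    have k0 : v₂ ∈ Submodule.span ℝ {v₂, w₁, w₂} := Submodule.subset_span (by simp)
    have k1 : w₁ ∈ Submodule.span ℝ {v₂, w₁, w₂} := Submodule.subset_span (by simp)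
    have k2 : w₂ ∈ Submodule.span ℝ {v₂, w₁, w₂} := Submodule.subset_span (by simp)
    have k3 : v₀ ∈ Submodule.span ℝ {v₂, w₁, w₂} := by
      rw [e0]; exact add_mem (Submodule.smul_mem _ _ k1) (Submodule.smul_mem _ _ k0)
    have k4 : y ∈ Submodule.span ℝ {v₂, w₁, w₂} := by
      rw [e1]; exact add_mem (Submodule.smul_mem _ _ k2) (Submodule.smul_mem _ _ k3)
    apply le_antisymm
    · rw [Submodule.span_le]
      rintro x (rfl | rfl | rfl)
      exacts [m2, mw1, mw2]
    · rw [Submodule.span_le]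
      rintro x (rfl | rfl | rfl)
      exacts [k3, k4, k0]
  have hneg : ∀ x ∈ perpOf n (Submodule.span ℝ {v₀, y, v₂}), x ≠ 0 → qform n x < 0 := by
    intro x hx hx0
    exact h_time n v₂ x (by rw [b22]; exact one_pos) (hx v₂ m2) hx0
  refine ⟨v₀, y, v₂, ?_, M0, hMy, M2, q0, b01, b22,
    ⟨v₂, w₁, w₂, hspan, c01, c02, c12, b22, c11, c22⟩, hneg, ?_, ?_⟩
  · rw [Fintype.linearIndependent_iff]
    intro g hg
    simp only [Fin.sum_univ_three, Matrix.cons_val] at hg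
    have t0 : bform n (g 0 • v₀ + g 1 • y + g 2 • v₂) v₀ = 0 := by rw [hg, h_zero_left]
    have t1 : bform n (g 0 • v₀ + g 1 • y + g 2 • v₂) y = 0 := by rw [hg, h_zero_left]
    have t2 : bform n (g 0 • v₀ + g 1 • y + g 2 • v₂) v₂ = 0 := by rw [hg, h_zero_left]
    simp only [h_add_left, h_smul_left, q0, b10, b20, b01, b11, b21, b02, b12', b22] at t0 t1 t2
    have g2 : g 2 = 0 := (mul_eq_zero.mp (by linarith : g 2 * β = 0)).resolve_right hβ.ne'
    rw [g2] at t1 t2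
    have g1 : g 1 = 0 := (mul_eq_zero.mp (by linarith : g 1 * β = 0)).resolve_right hβ.ne'
    rw [g1] at t2
    have g0 : g 0 = 0 := (mul_eq_zero.mp (by linarith : g 0 * β = 0)).resolve_right hβ.ne'
    intro i
    fin_cases i
    exacts [g0, g1, g2]
  · rw [Submodule.disjoint_def]
    intro x hx hx'
    by_contra hne
    have := hneg x hx' hne
    rw [h_qb, hx' x hx] at this
    exact lt_irrefl _ this
  · rw [codisjoint_iff, eq_top_iff]
    intro x _
    refine Submodule.mem_sup.mpr
      ⟨bform n x v₂ • v₂ - bform n x w₁ • w₁ - bform n x w₂ • w₂, ?_,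
        x - (bform n x v₂ • v₂ - bform n x w₁ • w₁ - bform n x w₂ • w₂), ?_, by abel⟩
    · exact sub_mem (sub_mem (Submodule.smul_mem _ _ m2) (Submodule.smul_mem _ _ mw1))
        (Submodule.smul_mem _ _ mw2)
    · intro w hw
      rw [← hspan] at hw
      induction hw using Submodule.span_induction with
      | mem w hw =>
        rcases hw with rfl | rfl | rfl
        · simp only [h_sub_left, h_smul_left, b22, h_comm n w₁, h_comm n w₂, c01, c02]
          ring
        · simp only [h_sub_left, h_smul_left, c11, c01, h_comm n w₂, c12]
          ring
        · simp only [h_sub_left, h_smul_left, c22, c12, c02]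
          ring
      | zero => rw [h_comm, h_zero_left]
      | add a b _ _ ha hb => rw [h_add_right, ha, hb, add_zero]
      | smul c a _ ha => rw [h_smul_right, ha, mul_zero]
end
end

section
/- Let M be a q-isometry (Mᵀ J M = J) that preserves the future cone, such that every complex eigenvalue of M has modulus 1 and M is not semisimple (i.e. M is of parabolic type). Then the subspace D = ker(M − Id) ∩ range(M − Id) of ℝ^{n+1} is one-dimensional and isotropic: q(v) = 0 for every v ∈ D. -/
open Matrix

noncomputable section

/-- The subspace `D = ker(M − Id) ∩ range(M − Id)` of `ℝ^{n+1}`. -/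
def Dsub (n : ℕ) (M : Matrix (Fin (n + 1)) (Fin (n + 1)) ℝ) :
    Submodule ℝ (Fin (n + 1) → ℝ) :=
  LinearMap.ker (M.mulVecLin - (LinearMap.id : (Fin (n + 1) → ℝ) →ₗ[ℝ] (Fin (n + 1) → ℝ))) ⊓
  LinearMap.range (M.mulVecLin - (LinearMap.id : (Fin (n + 1) → ℝ) →ₗ[ℝ] (Fin (n + 1) → ℝ)))


/-- The Minkowski bilinear form. -/
def mbil (n : ℕ) : LinearMap.BilinForm ℝ (Fin (n + 1) → ℝ) := Matrix.toBilin' (Jmat n)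

lemma mbil_apply (n : ℕ) (v w : Fin (n + 1) → ℝ) :
    mbil n v w = v 0 * w 0 - ∑ i : Fin n, v i.succ * w i.succ := by
  simp only [mbil, Matrix.toBilin'_apply', Jmat, dotProduct, mulVec_diagonal, Fin.sum_univ_succ]
  simp [Fin.succ_ne_zero, sub_eq_add_neg]

lemma qform_eq_mbil (n : ℕ) (v : Fin (n + 1) → ℝ) : qform n v = mbil n v v := by
  simp [mbil, Matrix.toBilin'_apply', qform]

lemma mbil_symm (n : ℕ) (v w : Fin (n + 1) → ℝ) : mbil n v w = mbil n w v := by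
  simp only [mbil_apply, mul_comm]

lemma mbil_isRefl (n : ℕ) : (mbil n).IsRefl := fun v w h => by rw [mbil_symm, h]

lemma mbil_inv (n : ℕ) (M : Matrix (Fin (n + 1)) (Fin (n + 1)) ℝ)
    (hM : Mᵀ * Jmat n * M = Jmat n) (v w : Fin (n + 1) → ℝ) :
    mbil n (M *ᵥ v) (M *ᵥ w) = mbil n v w := by
  simp only [mbil, Matrix.toBilin'_apply']
  conv_rhs => rw [← hM]
  rw [← mulVec_mulVec, ← mulVec_mulVec, dotProduct_mulVec v, vecMul_transpose]

lemma mbil_eq_zero_left (n : ℕ) (v : Fin (n + 1) → ℝ) (h : ∀ w, mbil n v w = 0) : v = 0 := by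
  funext i
  refine Fin.cases ?_ (fun j => ?_) i
  · have := h (Pi.single 0 1)
    simpa [mbil_apply, Pi.single_apply, Fin.succ_ne_zero] using this
  · have := h (Pi.single j.succ 1)
    simpa [mbil_apply, Pi.single_apply, (Fin.succ_ne_zero _).symm] using this

lemma mbil_nondeg (n : ℕ) : (mbil n).Nondegenerate := by
  refine ⟨fun v h => mbil_eq_zero_left n v h, fun v h => mbil_eq_zero_left n v fun w => ?_⟩
  rw [mbil_symm]; exact h w

/-- vectors orthogonal to a timelike vector are spacelike -/
lemma neg_of_orth (n : ℕ) (w y : Fin (n + 1) → ℝ) (hw : 0 < mbil n w w)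
    (h : mbil n y w = 0) (hy : y ≠ 0) : mbil n y y < 0 := by
  have cs := Finset.sum_mul_sq_le_sq_mul_sq Finset.univ
    (fun i : Fin n => y i.succ) (fun i : Fin n => w i.succ)
  rw [mbil_apply] at *
  simp only [← pow_two] at *
  have hY : 0 ≤ ∑ i : Fin n, y i.succ ^ 2 := Finset.sum_nonneg fun i _ => sq_nonneg _
  have hW : 0 ≤ ∑ i : Fin n, w i.succ ^ 2 := Finset.sum_nonneg fun i _ => sq_nonneg _
  have e : ∑ i : Fin n, y i.succ * w i.succ = y 0 * w 0 := by linarith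
  rw [e] at cs
  by_contra hc
  push Not at hc
  have hY0 : ∑ i : Fin n, y i.succ ^ 2 = 0 := by
    by_contra hne
    have : 0 < ∑ i : Fin n, y i.succ ^ 2 := lt_of_le_of_ne hY (Ne.symm hne)
    nlinarith
  have hi : ∀ i : Fin n, y i.succ = 0 := fun i => by
    have := (Finset.sum_eq_zero_iff_of_nonneg (fun i _ => sq_nonneg (y (Fin.succ i)))).1 hY0 i
      (Finset.mem_univ i)
    simpa using this
  have hw0 : w 0 ≠ 0 := by
    intro h0; rw [h0] at hw; nlinarith
  have hy0 : y 0 = 0 := by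
    rw [hY0] at cs
    have : (y 0 * w 0) ^ 2 = 0 := le_antisymm (by linarith) (sq_nonneg _)
    have := pow_eq_zero_iff (two_ne_zero) |>.1 this
    exact (mul_eq_zero.1 this).resolve_right hw0
  exact hy (funext fun i => Fin.cases hy0 hi i)

lemma inj_M (n : ℕ) (M : Matrix (Fin (n + 1)) (Fin (n + 1)) ℝ)
    (hM : Mᵀ * Jmat n * M = Jmat n) : Function.Injective M.mulVecLin := by
  rw [← LinearMap.ker_eq_bot, LinearMap.ker_eq_bot']
  intro v hv
  refine mbil_eq_zero_left n v fun w => ?_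
  rw [← mbil_inv n M hM]
  simp only [mulVecLin_apply] at hv
  simp [hv]

lemma semisimple_of_fix (n : ℕ) (M : Matrix (Fin (n + 1)) (Fin (n + 1)) ℝ)
    (hM : Mᵀ * Jmat n * M = Jmat n) (w : Fin (n + 1) → ℝ) (hw : 0 < mbil n w w)
    (hfix : M *ᵥ w = w) : IsSemisimpleMat n M := by
  intro p hp
  let B : LinearMap.BilinForm ℝ (Fin (n + 1) → ℝ) :=
    LinearMap.mk₂ ℝ (fun x y => 2 * mbil n x w * mbil n y w - mbil n w w * mbil n x y)
      (by intros; simp; ring) (by intros; simp; ring) (by intros; simp; ring)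
      (by intros; simp; ring)
  have hB : ∀ x y, B x y = 2 * mbil n x w * mbil n y w - mbil n w w * mbil n x y :=
    fun x y => rfl
  have hsym : ∀ x y, B x y = B y x := fun x y => by rw [hB, hB, mbil_symm n x y]; ring
  have hBinv : ∀ x y, B (M *ᵥ x) (M *ᵥ y) = B x y := fun x y => by
    have h1 : ∀ x, mbil n (M *ᵥ x) w = mbil n x w := fun x => by
      conv_lhs => rw [← hfix]
      exact mbil_inv n M hM x w
    rw [hB, hB, h1, h1, mbil_inv n M hM]
  have hpos : ∀ x, B x x = 0 → x = 0 := by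
    intro x hx
    rw [hB] at hx
    set a := mbil n x w
    set Q := mbil n w w
    let y := Q • x - a • w
    have hyw : mbil n y w = 0 := by simp [y, a, Q]; ring
    have hyy : mbil n y y = Q * (Q * mbil n x x - a ^ 2) := by
      simp [y, mbil_symm n w x]
      change Q * (Q * mbil n x x - a * a) - a * (Q * a - a * Q) = _
      ring
    have hy0 : y = 0 := by
      by_contra hne
      have := neg_of_orth n w y hw hyw hne
      rw [hyy] at this
      nlinarith [sq_nonneg a]
    have ha : a = 0 := by
      rw [hy0] at hyy
      simp only [map_zero] at hyy
      have := (mul_eq_zero.1 hyy.symm).resolve_left hw.ne'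
      have : a ^ 2 = 0 := by linarith
      simpa using this
    simp only [y, ha, zero_smul, sub_zero] at hy0
    exact (smul_eq_zero.1 hy0).resolve_left hw.ne'
  refine ⟨B.orthogonal p, ?_, ?_⟩
  · intro v hv m hm
    have hmaps : ∀ x ∈ p, M.mulVecLin x ∈ p := hp
    have hsur : Function.Surjective (M.mulVecLin.restrict hmaps) := by
      apply LinearMap.injective_iff_surjective.1
      intro a b hab
      apply Subtype.ext
      apply inj_M n M hM
      exact congrArg Subtype.val hab
    obtain ⟨m', hm'⟩ := hsur ⟨m, hm⟩
    have : M *ᵥ (m' : Fin (n + 1) → ℝ) = m := congrArg Subtype.val hm'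
    change B m (M *ᵥ v) = 0
    rw [← this, hBinv]
    exact hv m' m'.2
  · rw [LinearMap.BilinForm.isCompl_orthogonal_iff_disjoint (fun x y h => by rw [hsym, h])]
    rw [Submodule.disjoint_def]
    intro x hx hx'
    exact hpos x (hx' x hx)

lemma mbil_e0 (n : ℕ) (v : Fin (n + 1) → ℝ) : mbil n v (Pi.single 0 1) = v 0 := by
  simp [mbil_apply, Pi.single_apply, Fin.succ_ne_zero]

lemma cont_mbil (n : ℕ) : Continuous fun v : Fin (n + 1) → ℝ => mbil n v v := by
  simp only [mbil_apply]; fun_prop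

lemma cone_closed (n : ℕ) (M : Matrix (Fin (n + 1)) (Fin (n + 1)) ℝ)
    (hcone : PreservesFutureCone n M)
    (v : Fin (n + 1) → ℝ) (hv : 0 ≤ mbil n v v) (hv0 : 0 ≤ v 0) : 0 ≤ (M *ᵥ v) 0 := by
  have key : ∀ ε : ℝ, 0 < ε → 0 < (M *ᵥ v) 0 + ε * (M *ᵥ (Pi.single 0 1)) 0 := by
    intro ε hε
    have := (hcone (v + ε • Pi.single 0 1) ?_ ?_).2
    · simpa [mulVec_add, mulVec_smul] using this
    · rw [qform_eq_mbil]
      simp only [map_add, LinearMap.add_apply, map_smul, LinearMap.smul_apply, smul_eq_mul,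
        mbil_e0, mbil_symm n (Pi.single 0 1) v]
      simp
      nlinarith [mul_pos hε hε, mul_nonneg hε.le hv0]
    · simp; linarith
  by_contra hc
  push Not at hc
  have h1 := key 1 one_pos
  set A := (M *ᵥ v) 0
  set E := (M *ᵥ (Pi.single 0 1)) 0
  have hE : 0 < E := by linarith
  have := key (-A / E) (by apply div_pos <;> linarith)
  rw [div_mul_cancel₀ _ hE.ne'] at this
  linarith

lemma det_ne (n : ℕ) (M : Matrix (Fin (n + 1)) (Fin (n + 1)) ℝ)
    (hmod : ∀ z : ℂ, Polynomial.aeval z M.charpoly = 0 → ‖z‖ = 1) (s : ℝ)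
    (hs0 : 0 ≤ s) (hs1 : s < 1) : (1 - s • M).det ≠ 0 := by
  rcases hs0.eq_or_lt with rfl | hs
  · simp
  intro h
  have h2 : M.charpoly.eval (s⁻¹) = 0 := by
    rw [Matrix.eval_charpoly]
    have : scalar (Fin (n + 1)) s⁻¹ - M = s⁻¹ • (1 - s • M) := by
      rw [smul_sub, smul_smul, inv_mul_cancel₀ hs.ne', one_smul]
      congr 1
      ext i j; simp [Matrix.one_apply, Matrix.diagonal_apply]
    rw [this, det_smul, h, mul_zero]
  have h3 := hmod ((s⁻¹ : ℝ) : ℂ) (by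
    have := Polynomial.aeval_algebraMap_apply ℂ (s⁻¹ : ℝ) M.charpoly
    simp only [Polynomial.coe_aeval_eq_eval, h2, map_zero] at this
    exact this)
  rw [Complex.norm_real, Real.norm_eq_abs, abs_of_pos (inv_pos.2 hs)] at h3
  have h4 := mul_inv_cancel₀ hs.ne'
  rw [h3] at h4
  linarith

lemma y_exists (n : ℕ) (M : Matrix (Fin (n + 1)) (Fin (n + 1)) ℝ)
    (hM : Mᵀ * Jmat n * M = Jmat n) (hcone : PreservesFutureCone n M)
    (hmod : ∀ z : ℂ, Polynomial.aeval z M.charpoly = 0 → ‖z‖ = 1) (s : ℝ)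
    (hs0 : 0 ≤ s) (hs1 : s < 1) :
    ∃ y : Fin (n + 1) → ℝ, 0 < mbil n y y ∧ 0 < y 0 ∧ y - s • M *ᵥ y = Pi.single 0 1 := by
  let I := Set.Ico (0 : ℝ) 1
  let e : Fin (n + 1) → ℝ := Pi.single 0 1
  let y : I → (Fin (n + 1) → ℝ) := fun t =>
    (1 - (t : ℝ) • M).det⁻¹ • ((1 - (t : ℝ) • M).adjugate *ᵥ e)
  have hdet : ∀ t : I, (1 - (t : ℝ) • M).det ≠ 0 := fun t => det_ne n M hmod t t.2.1 t.2.2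
  have hcm : Continuous fun t : I => (1 - (t : ℝ) • M) := by fun_prop
  have hyc : Continuous y := by
    refine Continuous.smul (Continuous.inv₀ hcm.matrix_det hdet) ?_
    exact hcm.matrix_adjugate.matrix_mulVec continuous_const
  have hy : ∀ t : I, y t - (t : ℝ) • M *ᵥ (y t) = e := by
    intro t
    have : y t - (t : ℝ) • M *ᵥ (y t) = (1 - (t : ℝ) • M) *ᵥ y t := by
      rw [sub_mulVec, one_mulVec, smul_mulVec]
    rw [this]
    simp only [y]
    rw [mulVec_smul, mulVec_mulVec, mul_adjugate, smul_mulVec, one_mulVec, smul_smul,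
      inv_mul_cancel₀ (hdet t), one_smul]
  have himp : ∀ t : I, 0 ≤ mbil n (y t) (y t) → 0 ≤ y t 0 →
      0 < mbil n (y t) (y t) ∧ 0 < y t 0 := by
    intro t h1 h2
    have hm := cone_closed n M hcone _ h1 h2
    have hq := mbil_inv n M hM (y t) (y t)
    have he : y t = (t : ℝ) • M *ᵥ (y t) + e := by rw [← hy t]; abel
    have ht0 : (0 : ℝ) ≤ t := t.2.1
    generalize hz : M *ᵥ (y t) = z at *
    have hs : 0 ≤ (t : ℝ) * z 0 := mul_nonneg ht0 hm
    have h3 : 0 ≤ (t : ℝ) * ((t : ℝ) * mbil n z z) := by rw [hq]; positivity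
    rw [he]
    constructor
    · simp only [map_add, LinearMap.add_apply, map_smul, LinearMap.smul_apply, smul_eq_mul]
      rw [mbil_symm n e z]
      simp only [e, mbil_e0]
      simp
      linarith
    · simp [e]; linarith
  have hclopen : IsClopen {t : I | 0 < mbil n (y t) (y t) ∧ 0 < y t 0} := by
    have c1 : Continuous fun t => mbil n (y t) (y t) := (cont_mbil n).comp hyc
    have c2 : Continuous fun t => y t 0 := (continuous_apply 0).comp hyc
    constructor
    · have : {t : I | 0 < mbil n (y t) (y t) ∧ 0 < y t 0} =
          {t : I | 0 ≤ mbil n (y t) (y t)} ∩ {t | 0 ≤ y t 0} := by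
        ext t
        exact ⟨fun h => ⟨h.1.le, h.2.le⟩, fun h => himp t h.1 h.2⟩
      rw [this]
      exact (isClosed_le continuous_const c1).inter (isClosed_le continuous_const c2)
    · exact (isOpen_lt continuous_const c1).inter (isOpen_lt continuous_const c2)
  have : PreconnectedSpace I := Subtype.preconnectedSpace isPreconnected_Ico
  have huniv := hclopen.eq_univ ⟨⟨0, by simp [I]⟩, by
    have : y ⟨0, by simp [I]⟩ = e := by simp [y]
    simp only [Set.mem_ofPred_eq, this, e, mbil_e0]
    simp⟩
  have hmem : (⟨s, hs0, hs1⟩ : I) ∈ {t : I | 0 < mbil n (y t) (y t) ∧ 0 < y t 0} := by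
    rw [huniv]; trivial
  exact ⟨y ⟨s, hs0, hs1⟩, hmem.1, hmem.2, hy ⟨s, hs0, hs1⟩⟩

lemma fix_exists (n : ℕ) (M : Matrix (Fin (n + 1)) (Fin (n + 1)) ℝ)
    (hM : Mᵀ * Jmat n * M = Jmat n) (hcone : PreservesFutureCone n M)
    (hmod : ∀ z : ℂ, Polynomial.aeval z M.charpoly = 0 → ‖z‖ = 1) :
    ∃ u : Fin (n + 1) → ℝ, 0 ≤ mbil n u u ∧ u 0 = 1 ∧ M *ᵥ u = u := by
  let K : Set (Fin (n + 1) → ℝ) := {u | 0 ≤ mbil n u u ∧ u 0 = 1}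
  have hK : IsCompact K := by
    refine Metric.isCompact_of_isClosed_isBounded ?_ ?_
    · exact (isClosed_le continuous_const (cont_mbil n)).inter
        (isClosed_eq (continuous_apply 0) continuous_const)
    · refine (Metric.isBounded_closedBall (x := (0 : Fin (n + 1) → ℝ)) (r := 1)).subset ?_
      rintro u ⟨h1, h2⟩
      rw [mem_closedBall_zero_iff, pi_norm_le_iff_of_nonneg zero_le_one]
      intro i
      rw [Real.norm_eq_abs]
      refine Fin.cases ?_ (fun j => ?_) i
      · simp [h2]
      · rw [mbil_apply, h2] at h1
        have := Finset.single_le_sum (f := fun i : Fin n => u i.succ * u i.succ)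
          (fun i _ => mul_self_nonneg _) (Finset.mem_univ j)
        rw [← sq_le_one_iff_abs_le_one, pow_two]
        linarith
  have hseq : ∀ k : ℕ, ∃ u ∈ K, ∃ c : ℝ, 0 ≤ c ∧
      u - (1 - 1 / ((k : ℝ) + 1)) • M *ᵥ u = c • (Pi.single 0 1 : Fin (n + 1) → ℝ) := by
    intro k
    have hk : (0 : ℝ) < 1 / ((k : ℝ) + 1) := by positivity
    have hk1 : 1 / ((k : ℝ) + 1) ≤ 1 := by
      rw [div_le_one (by positivity)]; linarith [(Nat.cast_nonneg k : (0 : ℝ) ≤ k)]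
    obtain ⟨y, h1, h2, h3⟩ := y_exists n M hM hcone hmod (1 - 1 / ((k : ℝ) + 1))
      (by linarith) (by linarith)
    refine ⟨(y 0)⁻¹ • y, ⟨?_, ?_⟩, (y 0)⁻¹, by positivity, ?_⟩
    · simp only [map_smul, LinearMap.smul_apply, smul_eq_mul]; positivity
    · simp [h2.ne']
    · rw [← h3, mulVec_smul, smul_sub, smul_comm]
  choose u huK c hc0 hc using hseq
  obtain ⟨a, haK, φ, hφ, hlim⟩ := hK.tendsto_subseq huK
  have hs : Filter.Tendsto (fun k : ℕ => 1 - 1 / (((φ k : ℕ) : ℝ) + 1)) Filter.atTop (nhds 1) := by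
    have := (tendsto_one_div_add_atTop_nhds_zero_nat (𝕜 := ℝ)).comp hφ.tendsto_atTop
    simpa using this.const_sub 1
  have hMl : Filter.Tendsto (fun k => M *ᵥ (u (φ k))) Filter.atTop (nhds (M *ᵥ a)) :=
    ((Continuous.matrix_mulVec continuous_const continuous_id).tendsto a).comp hlim
  have hL : Filter.Tendsto (fun k => u (φ k) - (1 - 1 / (((φ k : ℕ) : ℝ) + 1)) • M *ᵥ (u (φ k)))
      Filter.atTop (nhds (a - (1 : ℝ) • M *ᵥ a)) := hlim.sub (hs.smul hMl)
  rw [one_smul] at hL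
  have hLi := fun i => (tendsto_pi_nhds.1 hL) i
  simp only [hc] at hLi
  set C := (a - M *ᵥ a) 0 with hC
  have hC0 : 0 ≤ C := ge_of_tendsto' (hLi 0) (fun k => by simpa using hc0 (φ k))
  have hCe : M *ᵥ a = a - C • (Pi.single 0 1 : Fin (n + 1) → ℝ) := by
    funext i
    refine Fin.cases ?_ (fun j => ?_) i
    · simp [hC]
    · have := hLi j.succ
      simp [Pi.single_apply] at this
      simp [Pi.single_apply]
      linarith
  obtain ⟨ha1, ha2⟩ := haK
  have hm := cone_closed n M hcone a ha1 (by rw [ha2]; exact zero_le_one)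
  have hq := mbil_inv n M hM a a
  rw [hCe] at hm hq
  simp only [map_sub, LinearMap.sub_apply, map_smul, LinearMap.smul_apply, smul_eq_mul,
    mbil_e0, mbil_symm n (Pi.single 0 1) a] at hq
  simp [ha2] at hm hq
  have : C = 0 := by
    by_contra hne
    have hpos : 0 < C := lt_of_le_of_ne hC0 (Ne.symm hne)
    have : C * (C - 2) = 0 := by linarith
    have := (mul_eq_zero.1 this).resolve_left hne
    linarith
  refine ⟨a, ha1, ha2, ?_⟩
  rw [hCe, this]; simp

lemma mem_Dsub (n : ℕ) (M : Matrix (Fin (n + 1)) (Fin (n + 1)) ℝ) (v : Fin (n + 1) → ℝ) :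
    v ∈ Dsub n M ↔ M *ᵥ v = v ∧ ∃ w, M *ᵥ w - w = v := by
  simp [Dsub, sub_eq_zero]

lemma Dsub_isotropic (n : ℕ) (M : Matrix (Fin (n + 1)) (Fin (n + 1)) ℝ)
    (hM : Mᵀ * Jmat n * M = Jmat n) (v : Fin (n + 1) → ℝ) (hv : v ∈ Dsub n M) :
    mbil n v v = 0 := by
  obtain ⟨h1, w, hw⟩ := (mem_Dsub n M v).1 hv
  have := mbil_inv n M hM v w
  rw [h1] at this
  conv_lhs => rw [← hw]
  rw [mbil_symm, hw, ← hw, map_sub, hw, this, sub_self]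

/-- Proposition 2.6, item (5): for a parabolic `q`-isometry, the subspace
`D = ker(M − Id) ∩ range(M − Id)` is a one-dimensional isotropic line. -/
theorem stmt_6 (n : ℕ) (hn : 1 ≤ n) (M : Matrix (Fin (n + 1)) (Fin (n + 1)) ℝ)
    (hM : Mᵀ * Jmat n * M = Jmat n) (hcone : PreservesFutureCone n M)
    (hmod : ∀ z : ℂ, Polynomial.aeval z M.charpoly = 0 → ‖z‖ = 1)
    (hnss : ¬ IsSemisimpleMat n M) :
    Module.finrank ℝ (Dsub n M) = 1 ∧ ∀ v ∈ Dsub n M, qform n v = 0 := by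
  refine ⟨?_, fun v hv => by rw [qform_eq_mbil]; exact Dsub_isotropic n M hM v hv⟩
  obtain ⟨x, hx1, hx2, hx3⟩ := fix_exists n M hM hcone hmod
  have hno : ∀ w, M *ᵥ w = w → mbil n w w ≤ 0 := fun w hw => by
    by_contra hc
    push Not at hc
    exact hnss (semisimple_of_fix n M hM w hc hw)
  have hxx : mbil n x x = 0 := le_antisymm (hno x hx3) hx1
  have hperp : ∀ y, M *ᵥ y = y → mbil n x y = 0 := by
    intro y hy
    by_contra hne
    -- use the fixed vectors `x + t y`
    have hfix : ∀ t : ℝ, 2 * t * mbil n x y + t ^ 2 * mbil n y y ≤ 0 := by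
      intro t
      have := hno (x + t • y) (by rw [mulVec_add, mulVec_smul, hx3, hy])
      simp only [map_add, LinearMap.add_apply, map_smul, LinearMap.smul_apply, smul_eq_mul,
        hxx, mbil_symm n y x] at this
      linarith
    have hyy := hno y hy
    set b := mbil n x y
    set Q := mbil n y y
    have hb : 0 < b ^ 2 := by positivity
    have hd : 0 < 1 - Q := by linarith
    have := hfix (b / (1 - Q))
    have h5 : 2 * (b / (1 - Q)) * b + (b / (1 - Q)) ^ 2 * Q =
        b ^ 2 * (2 - Q) / (1 - Q) ^ 2 := by
      field_simp; ring
    rw [h5] at this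
    have : 0 < b ^ 2 * (2 - Q) / (1 - Q) ^ 2 := by
      apply div_pos (mul_pos hb (by linarith)) (by positivity)
    linarith
  have hxD : x ∈ Dsub n M := by
    refine (mem_Dsub n M x).2 ⟨hx3, ?_⟩
    let R := LinearMap.range (M.mulVecLin - LinearMap.id)
    have hR : x ∈ (mbil n).orthogonal ((mbil n).orthogonal R) := by
      intro y hy
      change mbil n y x = 0
      rw [mbil_symm]
      apply hperp
      rw [← sub_eq_zero]
      obtain ⟨sur⟩ : Nonempty (Function.Surjective M.mulVecLin) :=
        ⟨LinearMap.injective_iff_surjective.1 (inj_M n M hM)⟩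
      refine mbil_eq_zero_left n _ fun w => ?_
      obtain ⟨w', rfl⟩ := sur w
      have h1 : mbil n (M *ᵥ w' - w') y = 0 := hy _ ⟨w', by simp⟩
      rw [map_sub, LinearMap.sub_apply] at h1 ⊢
      rw [mulVecLin_apply, mbil_inv n M hM, mbil_symm n y, mbil_symm n y]
      linarith
    rw [LinearMap.BilinForm.orthogonal_orthogonal (mbil_nondeg n) (mbil_isRefl n)] at hR
    obtain ⟨w, hw⟩ := hR
    exact ⟨w, by simpa using hw⟩
  refine finrank_eq_one_iff'.2 ⟨⟨x, hxD⟩, ?_, ?_⟩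
  · intro h
    have : x = 0 := congrArg Subtype.val h
    rw [this] at hx2
    simp at hx2
  · rintro ⟨v, hv⟩
    refine ⟨v 0, Subtype.ext ?_⟩
    change v 0 • x = v
    have hd : v 0 • x - v ∈ Dsub n M := (Dsub n M).sub_mem ((Dsub n M).smul_mem _ hxD) hv
    have h0 := Dsub_isotropic n M hM _ hd
    rw [← sub_eq_zero]
    by_contra hne
    have := neg_of_orth n (Pi.single 0 1) _ (by rw [mbil_e0]; simp)
      (by rw [mbil_e0]; simp [hx2]) hne
    linarith
end
end

section
/- Let M be a q-isometry (Mᵀ J M = J) that preserves the future cone, such that every complex eigenvalue of M has modulus 1 and M is not semisimple (i.e. M is of parabolic type). Then the norms of the powers of M grow quadratically: there exist constants c > 0 and C > 0 such that c·k² ≤ ‖Mᵏ‖ ≤ C·k² for every integer k ≥ 1. -/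
open Matrix

noncomputable section

/-- The operator norm of a square real matrix, acting on Euclidean space. -/
def matOpNorm {m : ℕ} (M : Matrix (Fin m) (Fin m) ℝ) : ℝ :=
  ‖Matrix.toEuclideanCLM (𝕜 := ℝ) M‖


/-- The Minkowski bilinear form. -/
def Bf (n : ℕ) : LinearMap.BilinForm ℝ (Fin (n + 1) → ℝ) := Matrix.toBilin' (Jmat n)

lemma Bf_apply (n : ℕ) (x y : Fin (n + 1) → ℝ) :
    Bf n x y = x 0 * y 0 - ∑ i : Fin n, x i.succ * y i.succ := by
  rw [Bf, Matrix.toBilin'_apply']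
  simp only [Jmat, Matrix.mulVec_diagonal, dotProduct, Fin.sum_univ_succ]
  simp [Fin.succ_ne_zero, Finset.sum_neg_distrib, sub_eq_add_neg]

lemma Bf_comm (n : ℕ) (x y : Fin (n + 1) → ℝ) : Bf n x y = Bf n y x := by
  simp only [Bf_apply, mul_comm]

lemma Bf_inv (n : ℕ) (M : Matrix (Fin (n + 1)) (Fin (n + 1)) ℝ)
    (hM : Mᵀ * Jmat n * M = Jmat n) (x y : Fin (n + 1) → ℝ) :
    Bf n (M *ᵥ x) (M *ᵥ y) = Bf n x y := by
  simp only [Bf, Matrix.toBilin'_apply']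
  conv_rhs => rw [← hM]
  rw [Matrix.dotProduct_mulVec, Matrix.dotProduct_mulVec, Matrix.dotProduct_mulVec,
    ← Matrix.vecMul_vecMul, ← Matrix.vecMul_vecMul, Matrix.vecMul_transpose,
    ← Matrix.dotProduct_mulVec (_ ᵥ* Jmat n)]

lemma eq_zero_of_null (n : ℕ) (x : Fin (n + 1) → ℝ) (h0 : x 0 = 0) (hx : 0 ≤ Bf n x x) :
    x = 0 := by
  rw [Bf_apply, h0] at hx
  have h : ∑ i : Fin n, x i.succ * x i.succ = 0 :=
    le_antisymm (by linarith) (Finset.sum_nonneg fun i _ => mul_self_nonneg _)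
  rw [Finset.sum_eq_zero_iff_of_nonneg (fun i _ => mul_self_nonneg _)] at h
  funext i
  refine Fin.cases h0 (fun i => ?_) i
  simpa using h i (Finset.mem_univ _)

lemma cs_space (n : ℕ) (x y : Fin (n + 1) → ℝ) :
    (∑ i : Fin n, x i.succ * y i.succ) ^ 2 ≤
      (∑ i : Fin n, x i.succ * x i.succ) * (∑ i : Fin n, y i.succ * y i.succ) := by
  have := Finset.sum_mul_sq_le_sq_mul_sq Finset.univ (fun i : Fin n => x i.succ)
    (fun i : Fin n => y i.succ)
  simpa only [sq] using this

/-- The form is negative semidefinite on the orthogonal of a null vector. -/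
lemma neg_semidef (n : ℕ) (e x : Fin (n + 1) → ℝ) (he : e ≠ 0) (hee : Bf n e e = 0)
    (hx : Bf n e x = 0) : Bf n x x ≤ 0 := by
  have h0 : e 0 ≠ 0 := fun h => he (eq_zero_of_null n e h hee.ge)
  have h := cs_space n e x
  rw [Bf_apply] at *
  have h1 : 0 < e 0 * e 0 := mul_self_pos.2 h0
  have h2 : ∑ i : Fin n, e i.succ * x i.succ = e 0 * x 0 := by linarith
  have h3 : ∑ i : Fin n, e i.succ * e i.succ = e 0 * e 0 := by linarith
  rw [h2, h3] at h
  have : e 0 * e 0 * (x 0 * x 0) ≤ e 0 * e 0 * ∑ i : Fin n, x i.succ * x i.succ := by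
    nlinarith
  have := le_of_mul_le_mul_left this h1
  linarith

lemma cs_orth (n : ℕ) (e x y : Fin (n + 1) → ℝ) (he : e ≠ 0) (hee : Bf n e e = 0)
    (hx : Bf n e x = 0) (hy : Bf n e y = 0) : (Bf n x y) ^ 2 ≤ Bf n x x * Bf n y y := by
  have := discrim_le_zero (a := -Bf n x x) (b := -2 * Bf n x y) (c := -Bf n y y) (fun t => by
    have := neg_semidef n e (t • x + y) he hee (by simp [hx, hy])
    simp only [map_add, map_smul, LinearMap.add_apply, LinearMap.smul_apply, smul_eq_mul,
      Bf_comm n y x] at this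
    linarith)
  rw [discrim] at this
  nlinarith

/-- The form is negative definite on the orthogonal of a timelike vector. -/
lemma neg_def (n : ℕ) (g z : Fin (n + 1) → ℝ) (hg : 0 < Bf n g g)
    (hz : Bf n g z = 0) (hzz : 0 ≤ Bf n z z) : z = 0 := by
  refine eq_zero_of_null n z ?_ hzz
  have h := cs_space n g z
  have hn : 0 ≤ ∑ i : Fin n, g i.succ * g i.succ :=
    Finset.sum_nonneg fun i _ => mul_self_nonneg _
  rw [Bf_apply] at *
  have h2 : ∑ i : Fin n, g i.succ * z i.succ = g 0 * z 0 := by linarith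
  rw [h2] at h
  have h4 : (∑ i : Fin n, g i.succ * g i.succ) * (∑ i : Fin n, z i.succ * z i.succ) ≤
    (∑ i : Fin n, g i.succ * g i.succ) * (z 0 * z 0) :=
    mul_le_mul_of_nonneg_left (by linarith) hn
  by_contra hne
  have : 0 < z 0 * z 0 := mul_self_pos.2 hne
  nlinarith

/-- Invariant subspaces have invariant complement when the orthogonal is transverse. -/
lemma exists_compl {V : Type*} [AddCommGroup V] [Module ℝ V] [FiniteDimensional ℝ V]
    (B : LinearMap.BilinForm ℝ V) (hB : B.IsRefl) (N : V →ₗ[ℝ] V) (hN : Function.Injective N)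
    (hinv : ∀ x y, B (N x) (N y) = B x y) (p : Submodule ℝ V) (hp : ∀ v ∈ p, N v ∈ p)
    (hd : Disjoint p (B.orthogonal p)) :
    (∀ v ∈ B.orthogonal p, N v ∈ B.orthogonal p) ∧ IsCompl p (B.orthogonal p) := by
  refine ⟨fun v hv => ?_, (LinearMap.BilinForm.isCompl_orthogonal_iff_disjoint hB).2 hd⟩
  rw [LinearMap.BilinForm.mem_orthogonal_iff] at hv ⊢
  intro x hx
  have hinj : Function.Injective (N.restrict hp) := fun a b hab => by
    apply Subtype.ext; apply hN
    simpa using congrArg Subtype.val hab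
  obtain ⟨⟨x', hx'⟩, hxx⟩ := (LinearMap.injective_iff_surjective.1 hinj) ⟨x, hx⟩
  have hxx' : N x' = x := by simpa using congrArg Subtype.val hxx
  have := hv x' hx'
  rw [← hxx', hinv, this]

lemma Bf_nondeg (n : ℕ) (x : Fin (n + 1) → ℝ) (h : ∀ y, Bf n x y = 0) : x = 0 := by
  have h0 : x 0 = 0 := by
    have := h (Pi.single 0 1)
    simpa [Bf_apply] using this
  exact eq_zero_of_null n x h0 (h x).ge

lemma inj_of_inv (n : ℕ) (N : (Fin (n + 1) → ℝ) →ₗ[ℝ] (Fin (n + 1) → ℝ))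
    (hinv : ∀ x y, Bf n (N x) (N y) = Bf n x y) : Function.Injective N := by
  rw [← LinearMap.ker_eq_bot, LinearMap.ker_eq_bot']
  intro x hx
  refine Bf_nondeg n x fun y => ?_
  rw [← hinv, hx]; simp

/-- A timelike fixed vector forces semisimplicity. -/
lemma semisimple_of_timelike (n : ℕ) (N : (Fin (n + 1) → ℝ) →ₗ[ℝ] (Fin (n + 1) → ℝ))
    (hinv : ∀ x y, Bf n (N x) (N y) = Bf n x y) (g : Fin (n + 1) → ℝ) (hg : 0 < Bf n g g)
    (hNg : N g = g) (p : Submodule ℝ (Fin (n + 1) → ℝ)) (hp : ∀ v ∈ p, N v ∈ p) :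
    ∃ p' : Submodule ℝ (Fin (n + 1) → ℝ), (∀ v ∈ p', N v ∈ p') ∧ IsCompl p p' := by
  let G : LinearMap.BilinForm ℝ (Fin (n + 1) → ℝ) :=
    (2 : ℝ) • LinearMap.BilinForm.linMulLin (Bf n g) (Bf n g) - (Bf n g g) • Bf n
  have hG : ∀ x y, G x y = 2 * (Bf n g x * Bf n g y) - Bf n g g * Bf n x y := by
    intro x y; simp [G]
  refine ⟨_, exists_compl G ?_ N (inj_of_inv n N hinv) ?_ p hp ?_⟩
  · intro x y h
    rw [hG] at *
    rw [Bf_comm n y x]; linarith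
  · intro x y
    have : ∀ x, Bf n g (N x) = Bf n g x := fun x => by
      conv_lhs => rw [← hNg]
      exact hinv _ _
    rw [hG, hG, this, this, hinv]
  · rw [Submodule.disjoint_def]
    intro x hx hx'
    rw [LinearMap.BilinForm.mem_orthogonal_iff] at hx'
    have h := hx' x hx
    rw [hG] at h
    set z := Bf n g g • x - Bf n g x • g with hz
    have hgz : Bf n g z = 0 := by simp [z]; ring
    have hzz : Bf n z z = Bf n g g * (Bf n g x) ^ 2 := by
      simp only [z, map_sub, map_smul, LinearMap.sub_apply, LinearMap.smul_apply, smul_eq_mul,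
        Bf_comm n x g]
      linear_combination (- Bf n g g) * h
    have hz0 := neg_def n g z hg hgz (by rw [hzz]; positivity)
    rw [hz0] at hzz
    have hgx : Bf n g x = 0 := by
      have : Bf n g g * (Bf n g x) ^ 2 = 0 := by simpa using hzz.symm
      rcases mul_eq_zero.1 this with h | h
      · exact absurd h hg.ne'
      · exact pow_eq_zero_iff (two_ne_zero) |>.1 h
    rw [hz0, hgx, zero_smul, sub_zero] at hz
    exact (smul_eq_zero.1 hz.symm).resolve_left (ne_of_gt hg)

/-- Growth of the time coefficient of a parabolic isometry fixing a null vector. -/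
lemma growth (n : ℕ) (N : (Fin (n + 1) → ℝ) →ₗ[ℝ] (Fin (n + 1) → ℝ))
    (hinv : ∀ x y, Bf n (N x) (N y) = Bf n x y) (e : Fin (n + 1) → ℝ) (he : e ≠ 0)
    (hee : Bf n e e = 0) (hNe : N e = e) (δ : Fin (n + 1) → ℝ) (hδ : Bf n δ δ = 1)
    (hns : ∀ g, N g = g → Bf n g g ≤ 0) :
    ∃ c C : ℝ, 0 < c ∧ 0 < C ∧ ∀ k : ℕ, 1 ≤ k →
      c * (k : ℝ) ^ 2 ≤ Bf n ((N ^ k) δ) δ ∧ Bf n ((N ^ k) δ) δ ≤ C * (k : ℝ) ^ 2 := by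
  have heN : ∀ x, Bf n e (N x) = Bf n e x := fun x => by
    conv_lhs => rw [← hNe]
    exact hinv _ _
  have heNk : ∀ (k : ℕ) x, Bf n e ((N ^ k) x) = Bf n e x := fun k x => by
    induction k with
    | zero => simp
    | succ k ih => rw [pow_succ', Module.End.mul_apply, heN, ih]
  have hinvk : ∀ (k : ℕ) x y, Bf n ((N ^ k) x) ((N ^ k) y) = Bf n x y := fun k x y => by
    induction k with
    | zero => simp
    | succ k ih => rw [pow_succ', Module.End.mul_apply, Module.End.mul_apply, hinv, ih]
  set d := N δ - δ with hd
  have hed : Bf n e d = 0 := by simp [d, heN]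
  have hδe : Bf n e δ ≠ 0 := by
    intro h
    have := neg_semidef n e δ he hee h
    linarith
  let S : ℕ → (Fin (n + 1) → ℝ) := fun k => (N ^ k) δ - δ
  have hS : ∀ k, S (k + 1) = S k + (N ^ k) d := fun k => by
    simp only [S, d, pow_succ, Module.End.mul_apply, map_sub]; abel
  have heS : ∀ k, Bf n e (S k) = 0 := fun k => by simp [S, heNk]
  have hqS : ∀ k, Bf n ((N ^ k) δ) δ = 1 + (- Bf n (S k) (S k)) / 2 := fun k => by
    simp only [S, map_sub, LinearMap.sub_apply, hinvk, hδ, Bf_comm n δ]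
    ring
  set r := - Bf n d d with hr
  have hr0 : 0 ≤ r := by have := neg_semidef n e d he hee hed; linarith
  have hup : ∀ k : ℕ, - Bf n (S k) (S k) ≤ (k : ℝ) ^ 2 * r := by
    intro k
    induction k with
    | zero => simp [S]
    | succ k ih =>
      have hcs := cs_orth n e (S k) ((N ^ k) d) he hee (heS k) (by rw [heNk, hed])
      rw [hinvk] at hcs
      have h1 : Bf n (S k) ((N ^ k) d) ^ 2 ≤ ((k : ℝ) * r) ^ 2 := by
        have : (- Bf n (S k) (S k)) * r ≤ (k : ℝ) ^ 2 * r * r :=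
          mul_le_mul_of_nonneg_right ih hr0
        rw [hr] at this ⊢
        nlinarith
      have h2 := (abs_le_of_sq_le_sq' h1 (by positivity)).1
      rw [hS]
      simp only [map_add, LinearMap.add_apply, hinvk, Bf_comm n ((N ^ k) d) (S k)]
      push_cast
      nlinarith
  -- separation
  let R : Submodule ℝ (Fin (n + 1) → ℝ) :=
    (LinearMap.ker (Bf n e)).map (N - LinearMap.id) ⊔ Submodule.span ℝ {e}
  have hdR : d ∉ R := by
    intro hmem
    obtain ⟨y, hy, z, hz, hyz⟩ := Submodule.mem_sup.1 hmem
    obtain ⟨v, hv, hvy⟩ := (Submodule.mem_map).1 hy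
    obtain ⟨s, rfl⟩ := Submodule.mem_span_singleton.1 hz
    have hev : Bf n e v = 0 := hv
    set f := δ - v with hf
    have hNf : N f = f + s • e := by
      simp only [LinearMap.sub_apply, LinearMap.id_apply] at hvy
      rw [← hvy, hd] at hyz
      simp only [f, map_sub]
      have : N δ = N v - v + s • e + δ := by rw [hyz]; abel
      rw [this]; abel
    have hef : Bf n e f = Bf n e δ := by simp [f, hev]
    have hs : s = 0 := by
      have h := hinv f f
      rw [hNf] at h
      simp only [map_add, map_smul, LinearMap.add_apply, LinearMap.smul_apply, smul_eq_mul,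
        hee, Bf_comm n f e, hef] at h
      have : s * Bf n e δ = 0 := by linarith
      exact (mul_eq_zero.1 this).resolve_right hδe
    rw [hs, zero_smul, add_zero] at hNf
    have := hns (f + ((1 - Bf n f f) / (2 * Bf n e δ)) • e) (by simp [hNf, hNe])
    simp only [map_add, map_smul, LinearMap.add_apply, LinearMap.smul_apply, smul_eq_mul,
        hee, Bf_comm n f e, hef] at this
    have h2 : (1 - Bf n f f) / (2 * Bf n e δ) * Bf n e δ = (1 - Bf n f f) / 2 := by
      field_simp
    linarith
  obtain ⟨φ, hφd, hφR⟩ := Submodule.exists_le_ker_of_notMem hdR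
  obtain ⟨w, hw⟩ : ∃ w, ∀ x, Bf n w x = φ x := by
    have hinj : Function.Injective (Bf n) := by
      rw [← LinearMap.ker_eq_bot, LinearMap.ker_eq_bot']
      intro x hx
      exact Bf_nondeg n x fun y => by rw [hx]; rfl
    obtain ⟨w, hw⟩ := (LinearMap.injective_iff_surjective_of_finrank_eq_finrank
      (Subspace.dual_finrank_eq (K := ℝ) (V := Fin (n + 1) → ℝ)).symm).1 hinj φ
    exact ⟨w, fun x => by rw [hw]⟩
  have hwe : Bf n e w = 0 := by
    rw [Bf_comm, hw]
    exact hφR (Submodule.mem_sup_right (Submodule.mem_span_singleton_self e))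
  have hwN : ∀ x, Bf n e x = 0 → φ (N x) = φ x := fun x hx => by
    have : φ ((N - LinearMap.id : _ →ₗ[ℝ] _) x) = 0 :=
      hφR (Submodule.mem_sup_left (Submodule.mem_map_of_mem hx))
    simp only [LinearMap.sub_apply, LinearMap.id_apply, map_sub] at this
    linarith
  have hwNk : ∀ k : ℕ, φ ((N ^ k) d) = φ d := fun k => by
    induction k with
    | zero => simp
    | succ k ih => rw [pow_succ', Module.End.mul_apply, hwN _ (by rw [heNk, hed]), ih]
  have hwS : ∀ k : ℕ, φ (S k) = k * φ d := fun k => by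
    induction k with
    | zero => simp [S]
    | succ k ih => rw [hS, map_add, hwNk, ih]; push_cast; ring
  have hlow : ∀ k : ℕ, ((k : ℝ) * φ d) ^ 2 ≤ (- Bf n w w) * (- Bf n (S k) (S k)) := fun k => by
    have := cs_orth n e w (S k) he hee hwe (heS k)
    rw [hw, hwS] at this
    linarith
  have hw0 : 0 < - Bf n w w := by
    have h1 := neg_semidef n e w he hee hwe
    rcases h1.lt_or_eq with h | h
    · linarith
    · have := hlow 1
      rw [h] at this
      have h3 : 0 < φ d ^ 2 := by positivity
      norm_num at this
      exact absurd this hφd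
  have hφ2 : 0 < φ d ^ 2 := by positivity
  refine ⟨φ d ^ 2 / (-Bf n w w) / 2, 1 + r / 2, by positivity, by positivity, fun k hk => ?_⟩
  have hk1 : (1 : ℝ) ≤ (k : ℝ) ^ 2 := by
    have : (1 : ℝ) ≤ k := by exact_mod_cast hk
    nlinarith
  rw [hqS]
  constructor
  · have : φ d ^ 2 / (-Bf n w w) * (k : ℝ) ^ 2 ≤ - Bf n (S k) (S k) := by
      rw [div_mul_eq_mul_div, div_le_iff₀ hw0]
      have := hlow k
      nlinarith
    linarith
  · have := hup k
    nlinarith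

lemma entry_le (n : ℕ) (A : Matrix (Fin (n + 1)) (Fin (n + 1)) ℝ)
    (hA : Aᵀ * Jmat n * A = Jmat n) (i j : Fin (n + 1)) : |A i j| ≤ 2 * |A 0 0| := by
  have hJ : Jmat n * Jmat n = 1 := by
    rw [Jmat, Matrix.diagonal_mul_diagonal, ← Matrix.diagonal_one]
    congr 1; funext i; split_ifs <;> norm_num
  have h1 : (Jmat n * Aᵀ * Jmat n) * A = 1 := by
    rw [Matrix.mul_assoc, Matrix.mul_assoc, ← Matrix.mul_assoc Aᵀ, hA, hJ]
  have h2 := mul_eq_one_comm.1 h1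
  have h3 : Aᵀᵀ * Jmat n * Aᵀ = Jmat n := by
    rw [Matrix.transpose_transpose]
    calc A * Jmat n * Aᵀ = A * (Jmat n * Aᵀ * Jmat n) * Jmat n := by
          simp only [Matrix.mul_assoc, hJ, Matrix.mul_one]
      _ = Jmat n := by rw [h2, Matrix.one_mul]
  have key : ∀ D : Matrix (Fin (n + 1)) (Fin (n + 1)) ℝ, Dᵀ * Jmat n * D = Jmat n →
      ∀ j, Bf n (Pi.single j 1) (Pi.single j 1) =
        D 0 j * D 0 j - ∑ i : Fin n, D i.succ j * D i.succ j := by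
    intro D hD j
    rw [← Bf_inv n D hD, Bf_apply]
    simp
  have le_one : ∀ j, Bf n (Pi.single j 1) (Pi.single j 1) =
      if j = 0 then 1 else -1 := by
    intro j
    simp [Bf, Jmat, Matrix.toBilin'_apply', Matrix.diagonal_apply]
  have single_le : ∀ (D : Matrix (Fin (n + 1)) (Fin (n + 1)) ℝ) (i : Fin n) j,
      D i.succ j * D i.succ j ≤ ∑ i : Fin n, D i.succ j * D i.succ j := fun D i j =>
    Finset.single_le_sum (f := fun i : Fin n => D i.succ j * D i.succ j)
      (fun i _ => mul_self_nonneg _) (Finset.mem_univ i)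
  have hcol0 : ∀ D : Matrix (Fin (n + 1)) (Fin (n + 1)) ℝ, Dᵀ * Jmat n * D = Jmat n →
      ∀ i, D i 0 * D i 0 ≤ D 0 0 * D 0 0 := by
    intro D hD i
    have := key D hD 0
    rw [le_one, if_pos rfl] at this
    refine Fin.cases le_rfl (fun i => ?_) i
    have := single_le D i 0
    linarith
  have hone : 1 ≤ A 0 0 * A 0 0 := by
    have := key A hA 0
    rw [le_one, if_pos rfl] at this
    have : 0 ≤ ∑ i : Fin n, A i.succ 0 * A i.succ 0 :=
      Finset.sum_nonneg fun i _ => mul_self_nonneg _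
    linarith
  have hrow : A 0 j * A 0 j ≤ A 0 0 * A 0 0 := hcol0 Aᵀ h3 j
  have hmain : A i j * A i j ≤ 4 * (A 0 0 * A 0 0) := by
    refine Fin.cases (by linarith) (fun i => ?_) i
    have h := key A hA j
    have h' : -1 ≤ Bf n (Pi.single j 1) (Pi.single j 1) := by
      rw [le_one]; split_ifs <;> norm_num
    have := single_le A i j
    linarith
  have : |A i j| ≤ |2 * A 0 0| := sq_le_sq.1 (by nlinarith)
  rwa [abs_mul, abs_two] at this

lemma norm_bounds (n : ℕ) : ∃ K : ℝ, 0 < K ∧ ∀ A : Matrix (Fin (n + 1)) (Fin (n + 1)) ℝ,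
    Aᵀ * Jmat n * A = Jmat n → |A 0 0| ≤ matOpNorm A ∧ matOpNorm A ≤ K * |A 0 0| := by
  let K0 : ℝ := ∑ i : Fin (n + 1), ∑ j : Fin (n + 1),
    matOpNorm (Matrix.single i j (1 : ℝ))
  have hK0 : 0 ≤ K0 := Finset.sum_nonneg fun i _ => Finset.sum_nonneg fun j _ => norm_nonneg _
  refine ⟨2 * K0 + 1, by positivity, fun A hA => ⟨?_, ?_⟩⟩
  · have h1 := (Matrix.toEuclideanCLM (𝕜 := ℝ) A).le_opNorm (WithLp.toLp 2 (Pi.single 0 1))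
    have h2 := PiLp.norm_apply_le
      (Matrix.toEuclideanCLM (𝕜 := ℝ) A (WithLp.toLp 2 (Pi.single 0 1))) 0
    have h3 : ‖(WithLp.toLp 2 (Pi.single 0 1) : EuclideanSpace ℝ (Fin (n + 1)))‖ = 1 := by
      simp
    rw [h3, mul_one] at h1
    refine le_trans ?_ (h2.trans h1)
    simp [Matrix.toEuclideanCLM_toLp]
  · have h : matOpNorm A ≤ ∑ i : Fin (n + 1), ∑ j : Fin (n + 1),
        2 * |A 0 0| * matOpNorm (Matrix.single i j (1 : ℝ)) := by
      conv_lhs => rw [Matrix.matrix_eq_sum_single A]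
      unfold matOpNorm
      simp only [map_sum]
      refine (norm_sum_le _ _).trans (Finset.sum_le_sum fun i _ => ?_)
      refine (norm_sum_le _ _).trans (Finset.sum_le_sum fun j _ => ?_)
      have : Matrix.single i j (A i j) = (A i j) • Matrix.single i j (1 : ℝ) := by
        simp [Matrix.smul_single]
      rw [this, map_smul, norm_smul]
      exact mul_le_mul_of_nonneg_right (entry_le n A hA i j) (norm_nonneg _)
    simp only [← Finset.mul_sum] at h
    have := abs_nonneg (A 0 0)
    change matOpNorm A ≤ 2 * |A 0 0| * K0 at h
    nlinarith

/-- Proposition 2.6, item (6): a parabolic `q`-isometry has quadratic norm growth: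
`c·k² ≤ ‖Mᵏ‖ ≤ C·k²` for all `k ≥ 1`. -/
theorem stmt_7 (n : ℕ) (hn : 1 ≤ n) (M : Matrix (Fin (n + 1)) (Fin (n + 1)) ℝ)
    (hM : Mᵀ * Jmat n * M = Jmat n) (hcone : PreservesFutureCone n M)
    (hmod : ∀ z : ℂ, Polynomial.aeval z M.charpoly = 0 → ‖z‖ = 1)
    (hnss : ¬ IsSemisimpleMat n M) :
    ∃ c C : ℝ, 0 < c ∧ 0 < C ∧ ∀ k : ℕ, 1 ≤ k →
      c * (k : ℝ) ^ 2 ≤ matOpNorm (M ^ k) ∧ matOpNorm (M ^ k) ≤ C * (k : ℝ) ^ 2 := by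
  have hinv := Bf_inv n M hM
  -- an invariant null line
  obtain ⟨e, he, hee, l, hMe⟩ : ∃ e : Fin (n + 1) → ℝ, e ≠ 0 ∧ Bf n e e = 0 ∧
      ∃ l : ℝ, M *ᵥ e = l • e := by
    unfold IsSemisimpleMat at hnss
    push Not at hnss
    obtain ⟨p, hp, hpc⟩ := hnss
    have hrefl : (Bf n).IsRefl := fun x y h => by rw [Bf_comm, h]
    have hinj := inj_of_inv n M.mulVecLin hinv
    have hdis : ¬ Disjoint p ((Bf n).orthogonal p) := fun hd => by
      obtain ⟨h1, h2⟩ := exists_compl (Bf n) hrefl M.mulVecLin hinj hinv p hp hd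
      exact hpc _ h1 h2
    have hinvo : ∀ v ∈ (Bf n).orthogonal p, M *ᵥ v ∈ (Bf n).orthogonal p := by
      intro v hv
      rw [LinearMap.BilinForm.mem_orthogonal_iff] at hv ⊢
      intro x hx
      have hinj' : Function.Injective (M.mulVecLin.restrict hp) := fun a b hab => by
        apply Subtype.ext; apply hinj
        exact congrArg Subtype.val hab
      obtain ⟨⟨x', hx'⟩, hxx⟩ := (LinearMap.injective_iff_surjective.1 hinj') ⟨x, hx⟩
      have hxx' : M *ᵥ x' = x := congrArg Subtype.val hxx
      have := hv x' hx'
      rw [← hxx', hinv, this]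
    rw [Submodule.disjoint_def] at hdis
    push Not at hdis
    obtain ⟨e, hep, heo, he⟩ := hdis
    have iso : ∀ x ∈ p ⊓ (Bf n).orthogonal p, Bf n x x = 0 := fun x hx =>
      (LinearMap.BilinForm.mem_orthogonal_iff.1 hx.2) x hx.1
    have hmem : e ∈ p ⊓ (Bf n).orthogonal p := ⟨hep, heo⟩
    have hMmem : M *ᵥ e ∈ p ⊓ (Bf n).orthogonal p := ⟨hp _ hep, hinvo _ heo⟩
    have hee := iso e hmem
    have h0 : e 0 ≠ 0 := fun h => he (eq_zero_of_null n e h hee.ge)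
    refine ⟨e, he, hee, (M *ᵥ e) 0 / e 0, ?_⟩
    have hz := eq_zero_of_null n (M *ᵥ e - ((M *ᵥ e) 0 / e 0) • e) (by simp [h0])
      (iso _ (Submodule.sub_mem _ hMmem (Submodule.smul_mem _ _ hmem))).ge
    exact sub_eq_zero.1 hz
  -- its eigenvalue is a sign
  have hl : l * l = 1 := by
    have hev : Module.End.HasEigenvalue (Matrix.toLin' M) l :=
      Module.End.hasEigenvalue_of_hasEigenvector
        (x := e) ⟨Module.End.mem_eigenspace_iff.2 (by simpa using hMe), he⟩
    rw [Module.End.hasEigenvalue_iff_isRoot_charpoly, Matrix.charpoly_toLin'] at hev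
    have h := hmod (l : ℂ) (by
      have h2 : Polynomial.aeval (algebraMap ℝ ℂ l) M.charpoly =
          algebraMap ℝ ℂ (Polynomial.aeval l M.charpoly) := Polynomial.aeval_algebraMap_apply _ _ _
      have h3 : Polynomial.aeval l M.charpoly = 0 := by
        rw [Polynomial.coe_aeval_eq_eval]; exact hev
      rw [h3, map_zero] at h2
      exact h2)
    rw [Complex.norm_real, Real.norm_eq_abs] at h
    rw [← abs_mul_abs_self, h, one_mul]
  have hl0 : l ≠ 0 := fun h => by rw [h] at hl; norm_num at hl
  let N : (Fin (n + 1) → ℝ) →ₗ[ℝ] (Fin (n + 1) → ℝ) := l • M.mulVecLin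
  have hNx : ∀ x, N x = l • (M *ᵥ x) := fun x => by simp [N]
  have hNinv : ∀ x y, Bf n (N x) (N y) = Bf n x y := fun x y => by
    rw [hNx, hNx]
    simp only [map_smul, LinearMap.smul_apply, smul_eq_mul, hinv]
    rw [← mul_assoc, hl, one_mul]
  have hNe : N e = e := by rw [hNx, hMe, smul_smul, hl, one_smul]
  have hNmem : ∀ (p : Submodule ℝ (Fin (n + 1) → ℝ)) v, N v ∈ p ↔ M *ᵥ v ∈ p := fun p v => by
    rw [hNx]; exact Submodule.smul_mem_iff p hl0
  have hns : ∀ g, N g = g → Bf n g g ≤ 0 := by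
    intro g hg
    by_contra hpos
    push Not at hpos
    apply hnss
    intro p hp
    obtain ⟨p', h1, h2⟩ := semisimple_of_timelike n N hNinv g hpos hg p
      (fun v hv => (hNmem p v).2 (hp v hv))
    exact ⟨p', fun v hv => (hNmem p' v).1 (h1 v hv), h2⟩
  have hNk : ∀ (k : ℕ) x, (N ^ k) x = l ^ k • ((M ^ k) *ᵥ x) := fun k => by
    induction k with
    | zero => simp
    | succ k ih =>
      intro x
      rw [pow_succ', Module.End.mul_apply, ih, hNx, Matrix.mulVec_smul, smul_smul,
        Matrix.mulVec_mulVec, pow_succ' M, pow_succ' l]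
  have hMk : ∀ k : ℕ, (M ^ k)ᵀ * Jmat n * (M ^ k) = Jmat n := fun k => by
    induction k with
    | zero => simp
    | succ k ih =>
      rw [pow_succ, Matrix.transpose_mul]
      calc Mᵀ * (M ^ k)ᵀ * Jmat n * (M ^ k * M)
          = Mᵀ * ((M ^ k)ᵀ * Jmat n * M ^ k) * M := by simp only [Matrix.mul_assoc]
        _ = Jmat n := by rw [ih, hM]
  obtain ⟨c, C, hc, hC, hcC⟩ := growth n N hNinv e he hee hNe (Pi.single 0 1)
    (by simp [Bf_apply]) hns
  obtain ⟨K, hK, hKA⟩ := norm_bounds n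
  refine ⟨c, K * C, hc, by positivity, fun k hk => ?_⟩
  obtain ⟨h1, h2⟩ := hcC k hk
  obtain ⟨h3, h4⟩ := hKA (M ^ k) (hMk k)
  have ha : Bf n ((N ^ k) (Pi.single 0 1)) (Pi.single 0 1) = l ^ k * (M ^ k) 0 0 := by
    rw [hNk, Bf_apply]; simp
  have habs : |l ^ k * (M ^ k) 0 0| = |(M ^ k) 0 0| := by
    have : |l| = 1 := by
      have h : |l| * |l| = 1 := by rw [abs_mul_abs_self, hl]
      nlinarith [abs_nonneg l]
    rw [abs_mul, abs_pow, this, one_pow, one_mul]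
  have hnn : 0 ≤ l ^ k * (M ^ k) 0 0 := by
    rw [← ha]; exact le_trans (by positivity) h1
  rw [abs_of_nonneg hnn] at habs
  rw [ha, habs] at h1 h2
  refine ⟨h1.trans h3, h4.trans ?_⟩
  rw [mul_assoc]
  exact mul_le_mul_of_nonneg_left h2 hK.le
end
end

section
/- Let L be a free abelian group of finite rank, let L' be a subgroup of L of finite index, and let φ' be a group automorphism of L'. Then there exist a positive integer k and a group automorphism φ of L such that φ(x) = φ'^k(x) for every x ∈ L'; in other words, some positive iterate of φ' extends to an automorphism of L. -/
/-- On a finitely generated abelian group, some positive iterate of an automorphism is the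
identity modulo `n`. -/
theorem aux_iterate (M : Type*) [AddCommGroup M] [Module.Finite ℤ M] (n : ℕ) (hn : n ≠ 0)
    (φ : AddAut M) : ∃ k : ℕ, 0 < k ∧ ∀ x : M, ∃ z : M, (k • φ) x = x + n • z := by
  let N : Submodule ℤ M := LinearMap.range (LinearMap.lsmul ℤ M (n : ℤ))
  have hN : ∀ x : M, x ∈ N ↔ ∃ z : M, n • z = x := by
    intro x
    simp [N, LinearMap.mem_range]
  have hfinQ : Finite (M ⧸ N) := by
    apply Module.finite_of_fg_torsion
    intro x
    obtain ⟨y, rfl⟩ := Submodule.Quotient.mk_surjective N x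
    refine ⟨⟨(n : ℤ), mem_nonZeroDivisors_of_ne_zero (by exact_mod_cast hn)⟩, ?_⟩
    change (n : ℤ) • (Submodule.Quotient.mk y : M ⧸ N) = 0
    rw [← Submodule.Quotient.mk_smul, Submodule.Quotient.mk_eq_zero, hN]
    exact ⟨y, by simp⟩
  let f : ℕ → (M ⧸ N) → (M ⧸ N) := fun k q => Submodule.Quotient.mk ((k • φ) (Quotient.out q))
  have hf : ∀ k (x : M), f k (Submodule.Quotient.mk x) = Submodule.Quotient.mk ((k • φ) x) := by
    intro k x
    simp only [f]
    rw [Submodule.Quotient.eq, ← map_sub]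
    have h : Quotient.out (Submodule.Quotient.mk x : M ⧸ N) - x ∈ N := by
      rw [← Submodule.Quotient.eq]
      exact Quotient.out_eq _
    obtain ⟨z, hz⟩ := (hN _).1 h
    rw [hN]
    exact ⟨(k • φ) z, by rw [← map_nsmul, hz]⟩
  obtain ⟨i, j, hij, hfe⟩ := Finite.exists_ne_map_eq_of_infinite f
  wlog hlt : i < j generalizing i j
  · exact this j i hij.symm hfe.symm (by omega)
  refine ⟨j - i, by omega, fun x => ?_⟩
  have h := congrFun hfe (Submodule.Quotient.mk ((-(i • φ)) x))
  rw [hf, hf] at h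
  have h1 : (i • φ) ((-(i • φ)) x) = x := by
    change (i • φ + -(i • φ)) x = x
    rw [add_neg_cancel]; rfl
  have h2 : (j • φ) ((-(i • φ)) x) = ((j - i) • φ) x := by
    conv_lhs => rw [show j = (j - i) + i by omega, add_nsmul]
    change ((j - i) • φ) ((i • φ) ((-(i • φ)) x)) = _
    rw [h1]
  rw [h1, h2] at h
  have h' := (Submodule.Quotient.eq N).1 h.symm
  obtain ⟨z, hz⟩ := (hN _).1 h'
  exact ⟨z, by rw [hz]; abel⟩

/-- An endomorphism of `L'` that is the identity mod `n` extends to `L` when `n L ⊆ L'`. -/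
theorem aux_extend (L : Type*) [AddCommGroup L] [IsAddTorsionFree L]
    (L' : AddSubgroup L) (n : ℕ) (hn : n ≠ 0) (hmem : ∀ y : L, n • y ∈ L')
    (ψ : AddAut L') (hψ : ∀ x : L', ∃ z : L', ψ x = x + n • z) :
    ∃ g : L →+ L, ∀ y : L, n • g y = (ψ ⟨n • y, hmem y⟩ : L) := by
  have hex : ∀ y : L, ∃ w : L, n • w = (ψ ⟨n • y, hmem y⟩ : L) := by
    intro y
    obtain ⟨z, hz⟩ := hψ ⟨n • y, hmem y⟩
    exact ⟨y + z, by rw [hz]; simp⟩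
  choose g hg using hex
  refine ⟨AddMonoidHom.mk' g fun a b => ?_, hg⟩
  apply nsmul_right_injective hn
  change n • g (a + b) = n • (g a + g b)
  rw [nsmul_add, hg, hg, hg, ← AddSubgroup.coe_add, ← map_add]
  congr 2
  ext
  simp

/-- Lemma 8.16: if `L'` is a finite-index subgroup of a finite-rank free abelian
group `L` and `φ'` is an automorphism of `L'`, then some positive iterate of `φ'`
extends to an automorphism of `L`. -/
theorem stmt_10 (L : Type*) [AddCommGroup L] [Module.Free ℤ L] [Module.Finite ℤ L]
    (L' : AddSubgroup L) (hfin : L'.FiniteIndex) (φ' : AddAut L') :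
    ∃ k : ℕ, 0 < k ∧ ∃ φ : AddAut L, ∀ x : L', φ (x : L) = (((k • φ') x : L') : L) := by
  have htf : IsAddTorsionFree L := 
    Module.isTorsionFree_int_iff_isAddTorsionFree.1 inferInstance
  have hn : L'.index ≠ 0 := hfin.index_ne_zero
  have hmem : ∀ y : L, L'.index • y ∈ L' := fun y => L'.nsmul_index_mem y
  generalize L'.index = n at hn hmem
  have hfg : Module.Finite ℤ L' :=
    inferInstanceAs (Module.Finite ℤ (AddSubgroup.toIntSubmodule L'))
  obtain ⟨k, hk, hψ⟩ := aux_iterate L' n hn φ'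
  refine ⟨k, hk, ?_⟩
  generalize k • φ' = ψ at hψ
  have hψ' : ∀ x : L', ∃ z : L', (-ψ) x = x + n • z := by
    intro x
    obtain ⟨z, hz⟩ := hψ ((-ψ) x)
    have h1 : ψ ((-ψ) x) = x := AddEquiv.apply_symm_apply ψ x
    rw [h1] at hz
    refine ⟨-z, ?_⟩
    rw [smul_neg]
    nth_rewrite 2 [hz]
    abel
  obtain ⟨g, hg⟩ := aux_extend L L' n hn hmem ψ hψ
  obtain ⟨g', hg'⟩ := aux_extend L L' n hn hmem (-ψ) hψ'
  refine ⟨{ g with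
    invFun := g'
    left_inv := fun y => ?_
    right_inv := fun y => ?_ }, fun x => ?_⟩
  · apply nsmul_right_injective hn
    change n • g' (g y) = n • y
    rw [hg']
    have : (⟨n • g y, hmem _⟩ : L') = ψ ⟨n • y, hmem y⟩ := Subtype.ext (hg y)
    rw [this]
    exact congrArg Subtype.val (AddEquiv.symm_apply_apply ψ _)
  · apply nsmul_right_injective hn
    change n • g (g' y) = n • y
    rw [hg]
    have : (⟨n • g' y, hmem _⟩ : L') = (-ψ) ⟨n • y, hmem y⟩ := Subtype.ext (hg' y)
    rw [this]
    exact congrArg Subtype.val (AddEquiv.apply_symm_apply ψ _)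
  · apply nsmul_right_injective hn
    change n • g x = n • ((ψ x : L') : L)
    rw [hg]
    have : (⟨n • (x : L), hmem x⟩ : L') = n • x := Subtype.ext (by simp)
    rw [this, map_nsmul, AddSubgroup.coe_nsmul]
end

section
/- Let B ∈ M₂(ℤ) be a symmetric matrix with det B < 0 such that the discriminant δ = −det B is a perfect square. Then the lattice (ℤ², B) has no hyperbolic isometry and its only direct isometries are ±Id: every matrix M ∈ M₂(ℤ) with det M = 1 and Mᵀ B M = B equals Id or −Id. -/
open Matrix

lemma aux_lin (B M : Matrix (Fin 2) (Fin 2) ℤ) (h : Mᵀ * B * M = B) :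
    M.det • (Mᵀ * B) = B * M.adjugate := by
  calc M.det • (Mᵀ * B) = (Mᵀ * B * M) * M.adjugate := by
        rw [Matrix.mul_assoc (Mᵀ * B), Matrix.mul_adjugate, Matrix.mul_smul, Matrix.mul_one]
    _ = _ := by rw [h]

lemma aux_arith (t u : ℤ) (h : t ^ 2 - 4 = u ^ 2) : u = 0 := by
  have key : ∀ t u : ℤ, 0 ≤ t → 0 ≤ u → t ^ 2 - 4 = u ^ 2 → u = 0 := by
    intro t u ht hu h
    have h1 : u < t := by nlinarith
    have h2 : u ≤ 1 := by nlinarith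
    have h3 : t ≤ 2 := by nlinarith
    interval_cases u <;> interval_cases t <;> simp_all
  have := key |t| |u| (abs_nonneg _) (abs_nonneg _) (by simpa using h)
  simpa using this

lemma aux_direct (B : Matrix (Fin 2) (Fin 2) ℤ) (hsym : Bᵀ = B) (hdet : B.det < 0)
    (hsq : IsSquare (-B.det)) (M : Matrix (Fin 2) (Fin 2) ℤ) (hd : M.det = 1)
    (h : Mᵀ * B * M = B) : M = 1 ∨ M = -1 := by
  have hl := aux_lin B M h
  rw [hd, one_smul, adjugate_fin_two] at hl
  have hb : B 1 0 = B 0 1 := congrFun (congrFun hsym 0) 1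
  have e00 := congrFun (congrFun hl 0) 0
  have e01 := congrFun (congrFun hl 0) 1
  have e11 := congrFun (congrFun hl 1) 1
  simp [Matrix.mul_apply, Fin.sum_univ_two, hb] at e00 e01 e11
  rw [det_fin_two] at hd hdet hsq
  rw [hb] at hdet hsq
  obtain ⟨k, hk⟩ := hsq
  have hM : ∀ p : ℤ, M 0 0 = p → M 0 1 = 0 → M 1 0 = 0 → M 1 1 = p → M = 1 ∨ M = -1 := by
    intro p h1 h2 h3 h4
    rw [h1, h2, h3, h4] at hd
    have : p = 1 ∨ p = -1 := by
      have : (p - 1) * (p + 1) = 0 := by linarith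
      rcases mul_eq_zero.mp this with h | h
      · left; linarith
      · right; linarith
    rcases this with rfl | rfl
    · left; ext i j; fin_cases i <;> fin_cases j <;> simp [h1, h2, h3, h4]
    · right; ext i j; fin_cases i <;> fin_cases j <;> simp [h1, h2, h3, h4]
  generalize M 0 0 = p at *
  generalize M 0 1 = q at *
  generalize M 1 0 = r at *
  generalize M 1 1 = s at *
  generalize B 0 0 = a at *
  generalize B 0 1 = b at *
  generalize B 1 1 = c at *
  have hk0 : k ≠ 0 := by rintro rfl; linarith
  have f0 : a * (s - p) = 2 * b * r := by linarith
  have f1 : r * c = - (a * q) := by linarith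
  have f2 : c * (s - p) = -(2 * b * q) := by linarith
  by_cases ha : a = 0
  · subst ha
    have hb0 : b ≠ 0 := by rintro rfl; simp at hdet
    have hr : r = 0 := by
      have : b * r = 0 := by linarith
      exact (mul_eq_zero.mp this).resolve_left hb0
    subst hr
    have hps : p = s := by
      have hps : p * s = 1 := by linarith
      rcases Int.eq_one_or_neg_one_of_mul_eq_one hps with rfl | rfl <;> linarith
    subst hps
    have hq : q = 0 := by
      have : b * q = 0 := by linarith
      exact (mul_eq_zero.mp this).resolve_left hb0
    exact hM p rfl hq rfl rfl
  · have key : a ^ 2 * ((p + s) ^ 2 - 4) = (2 * k * r) ^ 2 := by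
      linear_combination (4 * r ^ 2) * hk + (a * (s - p) + 2 * b * r) * f0 + 4 * a ^ 2 * hd + 4 * a * r * f1
    have hdvd : a ∣ 2 * k * r := by
      rw [← Int.pow_dvd_pow_iff (two_ne_zero)]
      exact ⟨_, key.symm⟩
    obtain ⟨u, hu⟩ := hdvd
    have h2 : (p + s) ^ 2 - 4 = u ^ 2 := by
      apply mul_left_cancel₀ (pow_ne_zero 2 ha)
      rw [key, hu]; ring
    have hu0 := aux_arith _ _ h2
    rw [hu0, mul_zero] at hu
    have hr : r = 0 := (mul_eq_zero.mp hu).resolve_left (by simpa using hk0)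
    subst hr
    have hs : s - p = 0 := (mul_eq_zero.mp (by linarith : a * (s - p) = 0)).resolve_left ha
    have hq : q = 0 := (mul_eq_zero.mp (by linarith : a * q = 0)).resolve_left ha
    exact hM p rfl hq rfl (by linarith)

lemma aux_trace (B : Matrix (Fin 2) (Fin 2) ℤ) (hsym : Bᵀ = B) (hdet : B.det < 0)
    (M : Matrix (Fin 2) (Fin 2) ℤ) (hd : M.det = -1)
    (h : Mᵀ * B * M = B) : M.trace = 0 := by
  have hl := aux_lin B M h
  rw [hd, adjugate_fin_two] at hl
  have hb : B 1 0 = B 0 1 := congrFun (congrFun hsym 0) 1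
  have e00 := congrFun (congrFun hl 0) 0
  have e01 := congrFun (congrFun hl 0) 1
  have e10 := congrFun (congrFun hl 1) 0
  simp [Matrix.mul_apply, Fin.sum_univ_two, hb] at e00 e01 e10
  rw [det_fin_two, hb] at hdet
  rw [trace_fin_two]
  have h1 : B 0 0 * (M 0 0 + M 1 1) = 0 := by linarith
  have h2 : B 0 1 * (M 0 0 + M 1 1) = 0 := by linarith
  by_contra h3
  have h4 := (mul_eq_zero.mp h1).resolve_right h3
  have h5 := (mul_eq_zero.mp h2).resolve_right h3
  rw [h4, h5] at hdet
  simp at hdet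

/-- Section 8.2.1: if the discriminant `δ = -det B` is a perfect square, then the
lattice `(ℤ², B)` has no hyperbolic isometry (every complex eigenvalue of an
isometry has modulus ≤ 1) and its only direct isometries are `±Id`. -/
theorem stmt_14 (B : Matrix (Fin 2) (Fin 2) ℤ) (hsym : Bᵀ = B) (hdet : B.det < 0)
    (hsq : IsSquare (-B.det)) :
    (∀ M : Matrix (Fin 2) (Fin 2) ℤ, Mᵀ * B * M = B →
      ∀ z : ℂ, Polynomial.aeval z M.charpoly = 0 → ‖z‖ ≤ 1) ∧
    (∀ M : Matrix (Fin 2) (Fin 2) ℤ, M.det = 1 → Mᵀ * B * M = B → M = 1 ∨ M = -1) := by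
  refine ⟨?_, fun M hd h => aux_direct B hsym hdet hsq M hd h⟩
  intro M h z hz
  have hz' : z ^ 2 - (M.trace : ℂ) * z + (M.det : ℂ) = 0 := by
    rw [charpoly_fin_two] at hz
    simpa using hz
  have hdd : M.det * M.det = 1 := by
    have := congrArg Matrix.det h
    rw [det_mul, det_mul, det_transpose] at this
    apply mul_left_cancel₀ hdet.ne
    linarith
  have : z = 1 ∨ z = -1 := by
    rcases Int.eq_one_or_neg_one_of_mul_eq_one hdd with hd | hd
    · rcases aux_direct B hsym hdet hsq M hd h with rfl | rfl
      · left
        rw [hd, trace_fin_two] at hz'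
        simp at hz'
        have : (z - 1) ^ 2 = 0 := by linear_combination hz'
        exact sub_eq_zero.mp (pow_eq_zero_iff two_ne_zero |>.mp this)
      · right
        rw [hd, trace_fin_two] at hz'
        simp at hz'
        have : (z + 1) ^ 2 = 0 := by linear_combination hz'
        exact eq_neg_of_add_eq_zero_left (pow_eq_zero_iff two_ne_zero |>.mp this)
    · rw [hd, aux_trace B hsym hdet M hd h] at hz'
      apply sq_eq_sq_iff_eq_or_eq_neg.mp
      push_cast at hz'
      linear_combination hz'
  rcases this with rfl | rfl <;> simp
end
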